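/- Let M = (ℤ, <, P₁, …, Pₙ) be a recurrent labelled linear ordering over ℤ, and let M' = (ℤ, <, P₁, …, Pₙ, P_{n+1}) be an expansion of M by a set P_{n+1} ⊆ ℤ satisfying property (*): for every finite word u over {0,1}ⁿ that occurs in every prefix and every suffix of w(M), every finite word u' over {0,1}^{n+1} whose letterwise projection to the first n components equals u occurs in every prefix and every suffix of w(M'). Then (1) P_{n+1} is not MSO-definable in M, and (2) the MSO theory of M' is recursive in (Turing reducible to) the MSO theory of M. -/

import Mathlib

namespace Paper

/-! ## Syntax and semantics of monadic second-order logic over labelled linear orders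

A labelled linear ordering `M = (A, <, P₁, …, Pₙ)` is represented by a type `A`,
a binary relation `r : A → A → Prop` (the order) and `P : Fin n → Set A`
(the unary predicates). -/

/-- MSO formulas over the signature `{<, P₀, …, P_{n-1}}`.  First-order
variables and second-order (set) variables are both indexed by `ℕ`. -/
inductive MSO (n : ℕ) : Type
  | lt (i j : ℕ) : MSO n
  | pred (k : Fin n) (i : ℕ) : MSO n
  | mem (i j : ℕ) : MSO n
  | not (φ : MSO n) : MSO n
  | and (φ ψ : MSO n) : MSO n
  | ex1 (i : ℕ) (φ : MSO n) : MSO n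
  | ex2 (j : ℕ) (φ : MSO n) : MSO n

namespace MSO

variable {n : ℕ}

/-- Satisfaction of an MSO formula in the structure `(A, r, P)` under the
first-order assignment `v` and the second-order assignment `V`. -/
def Sat {A : Type} (r : A → A → Prop) (P : Fin n → Set A)
    (v : ℕ → A) (V : ℕ → Set A) : MSO n → Prop
  | lt i j => r (v i) (v j)
  | pred k i => v i ∈ P k
  | mem i j => v i ∈ V j
  | not φ => ¬ Sat r P v V φ
  | and φ ψ => Sat r P v V φ ∧ Sat r P v V ψ
  | ex1 i φ => ∃ a : A, Sat r P (Function.update v i a) V φ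
  | ex2 j φ => ∃ S : Set A, Sat r P v (Function.update V j S) φ

/-- Quantifier depth of an MSO formula. -/
def qd : MSO n → ℕ
  | lt _ _ => 0
  | pred _ _ => 0
  | mem _ _ => 0
  | not φ => qd φ
  | and φ ψ => max (qd φ) (qd ψ)
  | ex1 _ φ => qd φ + 1
  | ex2 _ φ => qd φ + 1

/-- Free first-order variables of an MSO formula. -/
def fv1 : MSO n → Finset ℕ
  | lt i j => {i, j}
  | pred _ i => {i}
  | mem i _ => {i}
  | not φ => fv1 φ
  | and φ ψ => fv1 φ ∪ fv1 ψ
  | ex1 i φ => fv1 φ \ {i}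
  | ex2 _ φ => fv1 φ

/-- Free second-order variables of an MSO formula. -/
def fv2 : MSO n → Finset ℕ
  | lt _ _ => ∅
  | pred _ _ => ∅
  | mem _ j => {j}
  | not φ => fv2 φ
  | and φ ψ => fv2 φ ∪ fv2 ψ
  | ex1 _ φ => fv2 φ
  | ex2 j φ => fv2 φ \ {j}

/-- A sentence is a formula with no free variables. -/
def IsSentence (φ : MSO n) : Prop := fv1 φ = ∅ ∧ fv2 φ = ∅

/-- A sentence `φ` is true in the structure `(A, r, P)`. -/
def TrueIn {A : Type} (r : A → A → Prop) (P : Fin n → Set A) (φ : MSO n) : Prop :=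
  ∀ (v : ℕ → A) (V : ℕ → Set A), Sat r P v V φ

/-- `Q ⊆ A` is MSO-definable in `(A, r, P)`: there is a formula `φ(x)` whose only
free variable is the first-order variable `0` defining `Q`. -/
def Definable {A : Type} (r : A → A → Prop) (P : Fin n → Set A) (Q : Set A) : Prop :=
  ∃ φ : MSO n, fv1 φ ⊆ {0} ∧ fv2 φ = ∅ ∧
    ∀ a : A, a ∈ Q ↔ ∀ (v : ℕ → A) (V : ℕ → Set A), Sat r P (Function.update v 0 a) V φ

/-- A Gödel numbering of MSO formulas. -/
def encode : MSO n → ℕ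
  | lt i j => Nat.pair 0 (Nat.pair i j)
  | pred k i => Nat.pair 1 (Nat.pair k i)
  | mem i j => Nat.pair 2 (Nat.pair i j)
  | not φ => Nat.pair 3 (encode φ)
  | and φ ψ => Nat.pair 4 (Nat.pair (encode φ) (encode ψ))
  | ex1 i φ => Nat.pair 5 (Nat.pair i (encode φ))
  | ex2 j φ => Nat.pair 6 (Nat.pair j (encode φ))

/-- The MSO theory of the structure `(A, r, P)`, as a set of Gödel codes of the true
sentences. -/
def TheoryCodes {A : Type} (r : A → A → Prop) (P : Fin n → Set A) : Set ℕ :=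
  {c | ∃ φ : MSO n, IsSentence φ ∧ encode φ = c ∧ TrueIn r P φ}

/-- Two structures have the same `k`-type: they satisfy the same MSO sentences of
quantifier depth `≤ k`. -/
def EquivType (k : ℕ) {A B : Type} (r : A → A → Prop) (P : Fin n → Set A)
    (s : B → B → Prop) (Q : Fin n → Set B) : Prop :=
  ∀ φ : MSO n, IsSentence φ → qd φ ≤ k → (TrueIn r P φ ↔ TrueIn s Q φ)

/-- The `k`-type of a structure, as the set of Gödel codes of the true sentences
of quantifier depth `≤ k`. -/
def TypeSet (k : ℕ) {A : Type} (r : A → A → Prop) (P : Fin n → Set A) : Set ℕ :=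
  {c | ∃ φ : MSO n, IsSentence φ ∧ qd φ ≤ k ∧ encode φ = c ∧ TrueIn r P φ}

end MSO

/-- The order relation of the substructure with domain `S`. -/
def subRel {A : Type} (r : A → A → Prop) (S : Set A) : S → S → Prop :=
  fun x y => r x y

/-- The predicates of the substructure with domain `S`. -/
def subPred {A : Type} {n : ℕ} (P : Fin n → Set A) (S : Set A) : Fin n → Set S :=
  fun k => {x : S | (x : A) ∈ P k}

/-! ## Relative computability -/

/-- Partial recursiveness relative to an oracle `O` (Kleene-style, following
the definition of `Nat.Partrec`, with an extra base case for the oracle). -/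
inductive RecursiveIn (O : ℕ →. ℕ) : (ℕ →. ℕ) → Prop
  | zero : RecursiveIn O (pure 0)
  | succ : RecursiveIn O ↑Nat.succ
  | left : RecursiveIn O ↑fun n : ℕ => n.unpair.1
  | right : RecursiveIn O ↑fun n : ℕ => n.unpair.2
  | oracle : RecursiveIn O O
  | pair {f g} : RecursiveIn O f → RecursiveIn O g →
      RecursiveIn O fun n => Nat.pair <$> f n <*> g n
  | comp {f g} : RecursiveIn O f → RecursiveIn O g →
      RecursiveIn O fun n => g n >>= f
  | prec {f g} : RecursiveIn O f → RecursiveIn O g →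
      RecursiveIn O (Nat.unpaired fun a m =>
        m.rec (f a) fun y IH => do let i ← IH; g (Nat.pair a (Nat.pair y i)))
  | rfind {f} : RecursiveIn O f →
      RecursiveIn O fun a => Nat.rfind fun m => (fun x => x = 0) <$> f (Nat.pair a m)

/-- The characteristic (partial) function of a set of naturals. -/
noncomputable def chi (S : Set ℕ) : ℕ →. ℕ :=
  fun m => Part.some (S.indicator (fun _ => 1) m)

/-- `S` is recursive in (Turing reducible to) `T`. -/
def TuringRed (S T : Set ℕ) : Prop := RecursiveIn (chi T) (chi S)

/-- The (recursive) join of a finite family of sets of naturals. -/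
def finJoin {m : ℕ} (P : Fin m → Set ℕ) : Set ℕ :=
  {c | ∃ i : Fin m, ∃ x : ℕ, c = Nat.pair i x ∧ x ∈ P i}

/-- The (recursive) join of two sets of naturals. -/
def setJoin (S T : Set ℕ) : Set ℕ :=
  {c | (∃ a, c = 2 * a ∧ a ∈ S) ∨ (∃ a, c = 2 * a + 1 ∧ a ∈ T)}

/-- A set of naturals is decidable (computable). -/
def DecidableSet (S : Set ℕ) : Prop := ComputablePred (· ∈ S)

/-! ## Homogeneous sets for labelled orderings of the naturals -/

/-- `H = {h 0 < h 1 < ⋯}` is `k`-homogeneous for `(ℕ, <, P)`: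
all substructures `M_{[h i, h j)}`, `i < j`, have the same `k`-type. -/
def KHomogeneous {n : ℕ} (P : Fin n → Set ℕ) (h : ℕ → ℕ) (k : ℕ) : Prop :=
  ∀ i j i' j' : ℕ, i < j → i' < j' →
    MSO.EquivType k
      (subRel (· < ·) (Set.Ico (h i) (h j))) (subPred P (Set.Ico (h i) (h j)))
      (subRel (· < ·) (Set.Ico (h i') (h j'))) (subPred P (Set.Ico (h i') (h j')))

/-- `H = {h 0 < h 1 < ⋯}` is uniformly homogeneous for `(ℕ, <, P)`:
for each `k`, the set `{h k < h (k+1) < ⋯}` is `k`-homogeneous. -/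
def UniformlyHomogeneous {n : ℕ} (P : Fin n → Set ℕ) (h : ℕ → ℕ) : Prop :=
  StrictMono h ∧
  ∀ k : ℕ, KHomogeneous P (fun i => h (k + i)) k

/-! ## ℤ-words -/

/-- The finite word `u` occurs at position `i` in the `ℤ`-word `w`. -/
def OccursAt {σ : Type} (w : ℤ → σ) (u : List σ) (i : ℤ) : Prop :=
  ∀ k : Fin u.length, w (i + (k : ℕ)) = u.get k

/-- The finite word `u` occurs in the `ℤ`-word `w`. -/
def OccursIn {σ : Type} (w : ℤ → σ) (u : List σ) : Prop :=
  ∃ i : ℤ, OccursAt w u i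

/-- `u` occurs in every prefix of `w`. -/
def InEveryPrefix {σ : Type} (w : ℤ → σ) (u : List σ) : Prop :=
  ∀ n : ℤ, ∃ i : ℤ, i + u.length ≤ n ∧ OccursAt w u i

/-- `u` occurs in every suffix of `w`. -/
def InEverySuffix {σ : Type} (w : ℤ → σ) (u : List σ) : Prop :=
  ∀ n : ℤ, ∃ i : ℤ, n ≤ i ∧ OccursAt w u i

/-- A `ℤ`-word `w` is recurrent: for every regular language `X`, either no element
of `X` occurs in `w`, or every prefix and every suffix of `w` contains an
occurrence of some element of `X`. -/
def Recurrent {σ : Type} (w : ℤ → σ) : Prop :=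
  ∀ X : Language σ, X.IsRegular →
    (∀ u ∈ X, ¬ OccursIn w u) ∨
    (∀ n : ℤ, (∃ u ∈ X, ∃ i : ℤ, i + u.length ≤ n ∧ OccursAt w u i) ∧
              (∃ u ∈ X, ∃ i : ℤ, n ≤ i ∧ OccursAt w u i))

/-- The `ℤ`-word `w(M)` over the alphabet `{0,1}ⁿ` associated with the labelled
linear ordering `M = (ℤ, <, P₁, …, Pₙ)`. -/
def wordOf {n : ℕ} (P : Fin n → Set ℤ) : ℤ → (Fin n → Prop) :=
  fun i k => i ∈ P k

end Paper

open Paper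

namespace Paper

/-! ## Bi-infinite sequences and finite monoids -/

/-- A relation that is total in both directions admits a bi-infinite chain. -/
lemma exists_int_chain {α : Type*} [Nonempty α] (R : ℤ → α → α → Prop)
    (hf : ∀ i a, ∃ b, R i a b) (hb : ∀ i b, ∃ a, R i a b) :
    ∃ f : ℤ → α, ∀ i, R i (f i) (f (i + 1)) := by
  choose F hF using hf
  choose B hB using hb
  let a₀ : α := Classical.arbitrary α
  let up : ℕ → α := fun k => Nat.rec a₀ (fun k a => F (k : ℤ) a) k
  let down : ℕ → α := fun k => Nat.rec a₀ (fun k a => B (Int.negSucc k) a) k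
  let f : ℤ → α := fun i => match i with
    | Int.ofNat k => up k
    | Int.negSucc k => down (k + 1)
  refine ⟨f, fun i => ?_⟩
  match i with
  | Int.ofNat k => exact hF (k : ℤ) (up k)
  | Int.negSucc 0 => exact hB (Int.negSucc 0) a₀
  | Int.negSucc (k + 1) =>
    have h : Int.negSucc (k + 1) + 1 = Int.negSucc k := by omega
    rw [h]
    exact hB (Int.negSucc (k + 1)) (down (k + 1))

section FiniteMonoid

variable {S : Type*} [Monoid S] [Finite S]

lemma exists_pow_idempotent (a : S) : ∃ j : ℕ, a ^ (j + 1) * a ^ (j + 1) = a ^ (j + 1) := by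
  obtain ⟨i, p, hp, h⟩ : ∃ i p : ℕ, 0 < p ∧ a ^ i = a ^ (i + p) := by
    obtain ⟨i, i', hne, h⟩ := Finite.exists_ne_map_eq_of_infinite (fun n : ℕ => a ^ n)
    rcases lt_or_gt_of_ne hne with hlt | hlt
    · exact ⟨i, i' - i, by omega, by rw [show i + (i' - i) = i' by omega]; exact h⟩
    · exact ⟨i', i - i', by omega, by rw [show i' + (i - i') = i by omega]; exact h.symm⟩
  have hper : ∀ k d : ℕ, a ^ (i + d) = a ^ (i + d + k * p) := by
    intro k d
    induction k with
    | zero => simp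
    | succ k ih =>
      rw [ih, show i + d + (k + 1) * p = (i + p) + (d + k * p) by ring, pow_add a (i + p), ← h,
        ← pow_add]
      congr 1
      ring
  refine ⟨(i + 1) * p - 1, ?_⟩
  have hpos : 0 < (i + 1) * p := by positivity
  have hle : i ≤ (i + 1) * p := by nlinarith
  obtain ⟨d, hd⟩ := Nat.exists_eq_add_of_le hle
  rw [show (i + 1) * p - 1 + 1 = (i + 1) * p by omega, ← pow_add]
  have := hper (i + 1) d
  rw [← hd] at this
  exact this.symm

/-- In a finite monoid, a connected set of factors contains an element `z` generating a minimal
right ideal, together with an idempotent `e` generating the same right ideal. -/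
lemma exists_minimal_factor (F : Set S) (hne : F.Nonempty)
    (hconn : ∀ z ∈ F, ∃ r, z * r * z ∈ F) :
    ∃ z ∈ F, (∃ t, z * t * (z * t) = z * t ∧ z * t * z = z) ∧
      ∀ r, z * r * z ∈ F → ∃ c, z * r * z * c = z := by
  obtain ⟨z, hz, hmin⟩ := exists_minimalFor_of_wellFoundedLT (· ∈ F)
    (fun z : S => (Set.range (z * ·)).ncard) hne
  have hmin' : ∀ r, z * r * z ∈ F → ∃ c, z * r * z * c = z := by
    intro r hr
    have hsub : Set.range (z * r * z * ·) ⊆ Set.range (z * ·) := by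
      rintro _ ⟨c, rfl⟩
      exact ⟨r * z * c, by simp only [mul_assoc]⟩
    have heq := Set.eq_of_subset_of_ncard_le hsub
      (hmin hr (Set.ncard_le_ncard hsub)) (Set.toFinite _)
    have : z ∈ Set.range (z * r * z * ·) := heq ▸ ⟨1, mul_one z⟩
    exact this
  refine ⟨z, hz, ?_, hmin'⟩
  obtain ⟨r, hr⟩ := hconn z hz
  obtain ⟨c, hc⟩ := hmin' r hr
  obtain ⟨j, hj⟩ := exists_pow_idempotent (z * r)
  have hiter : ∀ k : ℕ, (z * r) ^ k * z * c ^ k = z := by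
    intro k
    induction k with
    | zero => simp
    | succ k ih =>
      calc (z * r) ^ (k + 1) * z * c ^ (k + 1)
          = (z * r) ^ k * (z * r * z * c) * c ^ k := by
            rw [pow_succ, pow_succ']
            simp only [mul_assoc]
        _ = z := by rw [hc, ih]
  have heq : z * (r * (z * r) ^ j) = (z * r) ^ (j + 1) := by
    rw [pow_succ', mul_assoc]
  refine ⟨r * (z * r) ^ j, by rw [heq, hj], ?_⟩
  rw [heq]
  calc (z * r) ^ (j + 1) * z = (z * r) ^ (j + 1) * ((z * r) ^ (j + 1) * z * c ^ (j + 1)) := by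
        rw [hiter]
    _ = (z * r) ^ (j + 1) * (z * r) ^ (j + 1) * z * c ^ (j + 1) := by simp only [mul_assoc]
    _ = z := by rw [hj, hiter]

/-- In a finite monoid, one-sided inverses relative to an idempotent are two-sided. -/
lemma corner_inverse_comm {e g k : S} (he : e * e = e) (hg : g * e = g) (hk : e * k = k)
    (h : g * k = e) : k * g = e := by
  let f : {x : S // e * x = x} → {x : S // e * x = x} :=
    fun x => ⟨k * x, by rw [← mul_assoc, hk]⟩
  have hinj : Function.Injective f := by
    intro x y hxy
    have hxy' : k * (x : S) = k * y := congrArg Subtype.val hxy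
    apply Subtype.ext
    calc (x : S) = g * k * x := by rw [h, x.2]
      _ = g * k * y := by rw [mul_assoc, hxy', mul_assoc]
      _ = y := by rw [h, y.2]
  obtain ⟨x, hx⟩ := Finite.injective_iff_surjective.mp hinj ⟨e, he⟩
  have hx' : k * (x : S) = e := congrArg Subtype.val hx
  have : (x : S) = g := by
    calc (x : S) = g * k * x := by rw [h, x.2]
      _ = g := by rw [mul_assoc, hx', hg]
  rw [← this, hx']

/-- A bi-infinite sequence whose elements are invertible relative to `e` can be refined to a
sequence which, after shifting the cuts, becomes constantly `e`. -/
lemma exists_zigzag {e : S} (he : e * e = e) (s k : ℤ → S) (hs : ∀ i, e * s i = s i)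
    (hek : ∀ i, e * k i = k i) (hke : ∀ i, k i * e = k i) (hsk : ∀ i, s i * e * k i = e) :
    ∃ x y : ℤ → S, (∀ i, e * x i = x i) ∧ (∀ i, e * y i = y i) ∧
      (∀ i, x i * y i = s i) ∧ ∀ i, y i * x (i + 1) = e := by
  have hks : ∀ i, k i * (s i * e) = e := fun i =>
    corner_inverse_comm he (by rw [mul_assoc, he]) (hek i) (hsk i)
  let A := {p : S × S // e * p.1 = p.1 ∧ p.1 * e = p.1 ∧ e * p.2 = p.2 ∧ p.1 * p.2 = e ∧
    p.2 * p.1 = e}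
  have : Nonempty A := ⟨⟨(e, e), he, he, he, he, he⟩⟩
  obtain ⟨f, hf⟩ : ∃ f : ℤ → A, ∀ i,
      (f (i + 1)).1.1 = (f i).1.1 * (s i * e) ∧ (f (i + 1)).1.2 = k i * (f i).1.2 := by
    refine exists_int_chain
      (fun i (p q : A) => q.1.1 = p.1.1 * (s i * e) ∧ q.1.2 = k i * p.1.2) ?_ ?_
    · rintro i ⟨⟨h, l⟩, h1, h2, h3, h4, h5⟩
      simp only at h1 h2 h3 h4 h5
      refine ⟨⟨(h * (s i * e), k i * l), ?_, ?_, ?_, ?_, ?_⟩, rfl, rfl⟩ <;> simp only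
      · rw [← mul_assoc, h1]
      · rw [mul_assoc, mul_assoc, he]
      · rw [← mul_assoc, hek]
      · rw [mul_assoc, ← mul_assoc _ (k i), hsk, ← mul_assoc, h2, h4]
      · rw [mul_assoc, ← mul_assoc l, h5, ← mul_assoc e, hs, hks]
    · rintro i ⟨⟨h, l⟩, h1, h2, h3, h4, h5⟩
      simp only at h1 h2 h3 h4 h5
      refine ⟨⟨(h * k i, s i * e * l), ?_, ?_, ?_, ?_, ?_⟩, ?_, ?_⟩ <;> simp only
      · rw [← mul_assoc, h1]
      · rw [mul_assoc, hke]
      · rw [← mul_assoc, ← mul_assoc, hs]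
      · rw [mul_assoc, ← mul_assoc (k i), hks, h3, h4]
      · rw [mul_assoc, ← mul_assoc l, h5, hek, hsk]
      · rw [mul_assoc, hks, h2]
      · rw [← mul_assoc, hks, h3]
  refine ⟨fun i => (f i).1.2, fun i => (f i).1.1 * s i, fun i => (f i).2.2.2.1, fun i => ?_,
      fun i => ?_, fun i => ?_⟩
  · rw [← mul_assoc, (f i).2.1]
  · simp only
    rw [← mul_assoc, (f i).2.2.2.2.2, hs]
  · simp only
    rw [(hf i).2, ← hek, mul_assoc e, ← mul_assoc, mul_assoc _ (s i), ← mul_assoc _ (k i),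
      mul_assoc _ _ (k i), hsk, (f i).2.2.1, (f i).2.2.2.2.1]

end FiniteMonoid

/-! ## Monadic types of labelled subsets of `ℤ` -/

/-- The atomic information about `m` sets: which pairs of sets intersect, and which pairs contain
elements in increasing order. -/
abbrev AtomicTy (m : ℕ) : Type := Fin m → Fin m → Prop × Prop

/-- The finite set of possible monadic types of rank `k` in `m` set variables. -/
def Ty : ℕ → ℕ → Type
  | 0, m => AtomicTy m
  | k + 1, m => AtomicTy m × Set (Ty k (m + 1))

instance Ty.finite : ∀ k m, Finite (Ty k m)
  | 0, m => inferInstanceAs (Finite (AtomicTy m))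
  | k + 1, m =>
    have := Ty.finite k (m + 1)
    inferInstanceAs (Finite (AtomicTy m × Set (Ty k (m + 1))))

/-- The atomic type of the sets `V 0, …, V (m - 1)` restricted to the domain `D`. -/
def atomicTy (m : ℕ) (D : Set ℤ) (V : ℕ → Set ℤ) : AtomicTy m := fun i j =>
  (∃ x ∈ D, x ∈ V i ∧ x ∈ V j, ∃ x ∈ D, ∃ y ∈ D, x < y ∧ x ∈ V i ∧ y ∈ V j)

/-- The monadic type of rank `k` of the sets `V 0, …, V (m - 1)` restricted to the domain `D`. -/
def ty : (k m : ℕ) → Set ℤ → (ℕ → Set ℤ) → Ty k m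
  | 0, m, D, V => atomicTy m D V
  | k + 1, m, D, V =>
    (atomicTy m D V, {τ | ∃ S : Set ℤ, ty k (m + 1) D (Function.update V m S) = τ})

variable {k m : ℕ} {D D' : Set ℤ} {V V' : ℕ → Set ℤ}

lemma atomicTy_eq_of_ty_eq (h : ty k m D V = ty k m D' V') :
    atomicTy m D V = atomicTy m D' V' := by
  cases k with
  | zero => exact h
  | succ k => exact congrArg Prod.fst h

lemma exists_ty_update_eq (h : ty (k + 1) m D V = ty (k + 1) m D' V') (S : Set ℤ) :
    ∃ S', ty k (m + 1) D (Function.update V m S) = ty k (m + 1) D' (Function.update V' m S') := by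
  have hset := congrArg Prod.snd h
  have hmem : ty k (m + 1) D (Function.update V m S) ∈
      {τ | ∃ S : Set ℤ, ty k (m + 1) D (Function.update V m S) = τ} := ⟨S, rfl⟩
  change _ = {τ | ∃ S : Set ℤ, ty k (m + 1) D' (Function.update V' m S) = τ} at hset
  change {τ | ∃ S : Set ℤ, ty k (m + 1) D (Function.update V m S) = τ} = _ at hset
  rw [hset] at hmem
  obtain ⟨S', hS'⟩ := hmem
  exact ⟨S', hS'.symm⟩

lemma ty_succ_eq (h : atomicTy m D V = atomicTy m D' V')
    (hl : ∀ S, ∃ S',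
      ty k (m + 1) D (Function.update V m S) = ty k (m + 1) D' (Function.update V' m S'))
    (hr : ∀ S', ∃ S,
      ty k (m + 1) D (Function.update V m S) = ty k (m + 1) D' (Function.update V' m S')) :
    ty (k + 1) m D V = ty (k + 1) m D' V' := by
  refine Prod.ext h (Set.ext fun τ => ⟨?_, ?_⟩)
  · rintro ⟨S, rfl⟩
    obtain ⟨S', hS'⟩ := hl S
    exact ⟨S', hS'.symm⟩
  · rintro ⟨S', rfl⟩
    obtain ⟨S, hS⟩ := hr S'
    exact ⟨S, hS⟩

/-- The type only depends on the relevant sets restricted to the domain. -/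
lemma ty_congr (h : ∀ j < m, ∀ x ∈ D, x ∈ V j ↔ x ∈ V' j) : ty k m D V = ty k m D V' := by
  have hat : ∀ {m : ℕ} {V V' : ℕ → Set ℤ}, (∀ j < m, ∀ x ∈ D, x ∈ V j ↔ x ∈ V' j) →
      atomicTy m D V = atomicTy m D V' := by
    intro m V V' h
    funext i j
    refine Prod.ext (propext ?_) (propext ?_)
    · exact exists_congr fun x => and_congr_right fun hx => by
        rw [h i i.2 x hx, h j j.2 x hx]
    · exact exists_congr fun x => and_congr_right fun hx => exists_congr fun y =>
        and_congr_right fun hy => by rw [h i i.2 x hx, h j j.2 y hy]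
  induction k generalizing m V V' with
  | zero => exact hat h
  | succ k ih =>
    have hupd : ∀ S, ty k (m + 1) D (Function.update V m S) =
        ty k (m + 1) D (Function.update V' m S) := by
      intro S
      apply ih
      intro j hj x hx
      rcases eq_or_ne j m with rfl | hne
      · simp
      · simp only [Function.update_of_ne hne]
        exact h j (by omega) x hx
    exact ty_succ_eq (hat h) (fun S => ⟨S, hupd S⟩) (fun S => ⟨S, hupd S⟩)

/-- The elements of the domain `D` that the map `p` sends to `i`. -/
def block (D : Set ℤ) (p : ℤ → ℤ) (i : ℤ) : Set ℤ := {x | x ∈ D ∧ p x = i}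

lemma atomicTy_sum_imp {p p' : ℤ → ℤ} (hp : MonotoneOn p D)
    (hp' : MonotoneOn p' D')
    (h : ∀ i, atomicTy m (block D p i) V = atomicTy m (block D' p' i) V') (i j : Fin m) :
    ((atomicTy m D V i j).1 → (atomicTy m D' V' i j).1) ∧
      ((atomicTy m D V i j).2 → (atomicTy m D' V' i j).2) := by
  have h1 : ∀ q (i j : Fin m), (∃ x ∈ block D p q, x ∈ V i ∧ x ∈ V j) →
      ∃ x ∈ block D' p' q, x ∈ V' i ∧ x ∈ V' j := fun q i j =>
    (congrArg Prod.fst (congrFun (congrFun (h q) i) j)).mp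
  have h2 : ∀ q (i j : Fin m),
      (∃ x ∈ block D p q, ∃ y ∈ block D p q, x < y ∧ x ∈ V i ∧ y ∈ V j) →
      ∃ x ∈ block D' p' q, ∃ y ∈ block D' p' q, x < y ∧ x ∈ V' i ∧ y ∈ V' j := fun q i j =>
    (congrArg Prod.snd (congrFun (congrFun (h q) i) j)).mp
  constructor
  · rintro ⟨x, hx, hxi, hxj⟩
    obtain ⟨x', hx', hV⟩ := h1 (p x) i j ⟨x, ⟨hx, rfl⟩, hxi, hxj⟩
    exact ⟨x', hx'.1, hV⟩
  · rintro ⟨x, hx, y, hy, hxy, hxi, hyj⟩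
    rcases (hp hx hy hxy.le).eq_or_lt with heq | hlt
    · obtain ⟨x', hx', y', hy', hV⟩ := h2 (p x) i j ⟨x, ⟨hx, rfl⟩, y, ⟨hy, heq.symm⟩, hxy, hxi, hyj⟩
      exact ⟨x', hx'.1, y', hy'.1, hV⟩
    · obtain ⟨x', hx', hxi', -⟩ := h1 (p x) i i ⟨x, ⟨hx, rfl⟩, hxi, hxi⟩
      obtain ⟨y', hy', hyj', -⟩ := h1 (p y) j j ⟨y, ⟨hy, rfl⟩, hyj, hyj⟩
      refine ⟨x', hx'.1, y', hy'.1, ?_, hxi', hyj'⟩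
      by_contra hle
      have := hp' hy'.1 hx'.1 (not_lt.mp hle)
      rw [hx'.2, hy'.2] at this
      omega

lemma exists_ty_sum_update {p p' : ℤ → ℤ}
    (h : ∀ i, ty (k + 1) m (block D p i) V = ty (k + 1) m (block D' p' i) V') (S : Set ℤ) :
    ∃ S', ∀ i, ty k (m + 1) (block D p i) (Function.update V m S) =
      ty k (m + 1) (block D' p' i) (Function.update V' m S') := by
  choose f hf using fun i => exists_ty_update_eq (h i) S
  refine ⟨{x | x ∈ f (p' x)}, fun i => (hf i).trans (ty_congr ?_)⟩
  rintro j hj x ⟨hx, rfl⟩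
  rcases eq_or_ne j m with rfl | hne
  · simp
  · simp only [Function.update_of_ne hne]

/-- Composition: the type of an ordered sum is determined by the types of the summands. -/
lemma ty_sum {p p' : ℤ → ℤ} (hp : MonotoneOn p D) (hp' : MonotoneOn p' D')
    (h : ∀ i, ty k m (block D p i) V = ty k m (block D' p' i) V') :
    ty k m D V = ty k m D' V' := by
  have hat : ∀ {m : ℕ} {V V' : ℕ → Set ℤ},
      (∀ i, atomicTy m (block D p i) V = atomicTy m (block D' p' i) V') →
      atomicTy m D V = atomicTy m D' V' := by
    intro m V V' h
    funext i j
    have hl := atomicTy_sum_imp hp hp' h i j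
    have hr := atomicTy_sum_imp hp' hp (fun q => (h q).symm) i j
    exact Prod.ext (propext ⟨hl.1, hr.1⟩) (propext ⟨hl.2, hr.2⟩)
  induction k generalizing m V V' with
  | zero => exact hat h
  | succ k ih =>
    refine ty_succ_eq (hat fun i => atomicTy_eq_of_ty_eq (h i)) (fun S => ?_) (fun S' => ?_)
    · obtain ⟨S', hS'⟩ := exists_ty_sum_update h S
      exact ⟨S', ih hS'⟩
    · obtain ⟨S, hS⟩ := exists_ty_sum_update (fun i => (h i).symm) S'
      exact ⟨S, ih fun i => (hS i).symm⟩

/-- Translating the domain and the sets does not change the type. -/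
lemma ty_translate (t : ℤ) (h : ∀ x, x ∈ D ↔ x + t ∈ D')
    (hV : ∀ j < m, ∀ x ∈ D, x ∈ V j ↔ x + t ∈ V' j) : ty k m D V = ty k m D' V' := by
  have hat : ∀ {m : ℕ} {V V' : ℕ → Set ℤ}, (∀ j < m, ∀ x ∈ D, x ∈ V j ↔ x + t ∈ V' j) →
      atomicTy m D V = atomicTy m D' V' := by
    intro m V V' hV
    funext i j
    refine Prod.ext (propext ⟨?_, ?_⟩) (propext ⟨?_, ?_⟩)
    · rintro ⟨x, hx, hi, hj⟩
      exact ⟨x + t, (h x).mp hx, (hV i i.2 x hx).mp hi, (hV j j.2 x hx).mp hj⟩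
    · rintro ⟨x, hx, hi, hj⟩
      rw [← sub_add_cancel x t] at hx hi hj
      have hx' := (h _).mpr hx
      exact ⟨x - t, hx', (hV i i.2 _ hx').mpr hi, (hV j j.2 _ hx').mpr hj⟩
    · rintro ⟨x, hx, y, hy, hxy, hi, hj⟩
      exact ⟨x + t, (h x).mp hx, y + t, (h y).mp hy, by omega, (hV i i.2 x hx).mp hi,
        (hV j j.2 y hy).mp hj⟩
    · rintro ⟨x, hx, y, hy, hxy, hi, hj⟩
      rw [← sub_add_cancel x t] at hx hi
      rw [← sub_add_cancel y t] at hy hj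
      have hx' := (h _).mpr hx
      have hy' := (h _).mpr hy
      exact ⟨x - t, hx', y - t, hy', by omega, (hV i i.2 _ hx').mpr hi, (hV j j.2 _ hy').mpr hj⟩
  induction k generalizing m V V' with
  | zero => exact hat hV
  | succ k ih =>
    have hupd : ∀ S S' : Set ℤ, (∀ x, x ∈ S ↔ x + t ∈ S') →
        ty k (m + 1) D (Function.update V m S) = ty k (m + 1) D' (Function.update V' m S') := by
      intro S S' hS
      apply ih
      intro j hj x hx
      rcases eq_or_ne j m with rfl | hne
      · simpa using hS x
      · simp only [Function.update_of_ne hne]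
        exact hV j (by omega) x hx
    exact ty_succ_eq (hat hV)
      (fun S => ⟨{x | x - t ∈ S}, hupd _ _ fun x => by simp⟩)
      (fun S' => ⟨{x | x + t ∈ S'}, hupd _ _ fun x => Iff.rfl⟩)

section Determination

variable {k m : ℕ} {W W' : ℕ → Set ℤ}

lemma inter_iff_of_ty_eq (h : ty k m Set.univ W = ty k m Set.univ W') {i j : ℕ} (hi : i < m)
    (hj : j < m) : (∃ x, x ∈ W i ∧ x ∈ W j) ↔ ∃ x, x ∈ W' i ∧ x ∈ W' j := by
  have := (congrArg Prod.fst (congrFun (congrFun (atomicTy_eq_of_ty_eq h) ⟨i, hi⟩) ⟨j, hj⟩))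
  simpa [atomicTy] using this

lemma lt_iff_of_ty_eq (h : ty k m Set.univ W = ty k m Set.univ W') {i j : ℕ} (hi : i < m)
    (hj : j < m) :
    (∃ x y, x < y ∧ x ∈ W i ∧ y ∈ W j) ↔ ∃ x y, x < y ∧ x ∈ W' i ∧ y ∈ W' j := by
  have := (congrArg Prod.snd (congrFun (congrFun (atomicTy_eq_of_ty_eq h) ⟨i, hi⟩) ⟨j, hj⟩))
  simpa [atomicTy] using this

lemma exists_ty_update_singleton_eq (h : ty (k + 1) m Set.univ W = ty (k + 1) m Set.univ W')
    (a : ℤ) : ∃ b : ℤ, ty k (m + 1) Set.univ (Function.update W m {a}) =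
      ty k (m + 1) Set.univ (Function.update W' m {b}) := by
  obtain ⟨S, hS⟩ := exists_ty_update_eq h {a}
  have h1 := inter_iff_of_ty_eq hS (Nat.lt_succ_self m) (Nat.lt_succ_self m)
  have h2 := lt_iff_of_ty_eq hS (Nat.lt_succ_self m) (Nat.lt_succ_self m)
  simp only [Function.update_self, Set.mem_singleton_iff, and_self, exists_eq, true_iff] at h1 h2
  obtain ⟨b, hb⟩ := h1
  suffices S = {b} by exact ⟨b, this ▸ hS⟩
  have hno : ¬ ∃ x y, x < y ∧ x ∈ S ∧ y ∈ S := by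
    rw [← h2]
    rintro ⟨x, y, hxy, rfl, rfl⟩
    exact lt_irrefl _ hxy
  refine Set.Subset.antisymm (fun x hx => ?_) (Set.singleton_subset_iff.mpr hb)
  rcases lt_trichotomy x b with hlt | heq | hlt
  · exact (hno ⟨x, b, hlt, hx, hb⟩).elim
  · exact heq
  · exact (hno ⟨b, x, hlt, hb, hx⟩).elim

/-- Satisfaction of a formula of quantifier depth at most `k` is determined by the type of
rank `k`, where first-order variables are represented by singletons. -/
lemma sat_iff_of_ty_eq {N : ℕ} (φ : MSO N) (hk : φ.qd ≤ k)
    (hty : ty k m Set.univ W = ty k m Set.univ W') {α β : ℕ → ℕ} {γ : Fin N → ℕ}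
    {v v' : ℕ → ℤ} {V V' : ℕ → Set ℤ} {P P' : Fin N → Set ℤ}
    (hα : ∀ i ∈ φ.fv1, α i < m ∧ W (α i) = {v i} ∧ W' (α i) = {v' i})
    (hβ : ∀ j ∈ φ.fv2, β j < m ∧ W (β j) = V j ∧ W' (β j) = V' j)
    (hγ : ∀ a, γ a < m ∧ W (γ a) = P a ∧ W' (γ a) = P' a) :
    MSO.Sat (fun x y : ℤ => x < y) P v V φ ↔ MSO.Sat (fun x y : ℤ => x < y) P' v' V' φ := by
  induction φ generalizing k m W W' α β v v' V V' with
  | lt i j =>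
    obtain ⟨hi, hi1, hi2⟩ := hα i (by simp [MSO.fv1])
    obtain ⟨hj, hj1, hj2⟩ := hα j (by simp [MSO.fv1])
    simpa [hi1, hi2, hj1, hj2, MSO.Sat, and_comm, and_left_comm, and_assoc] using
      lt_iff_of_ty_eq hty hi hj
  | pred a i =>
    obtain ⟨hi, hi1, hi2⟩ := hα i (by simp [MSO.fv1])
    obtain ⟨hj, hj1, hj2⟩ := hγ a
    simpa [hi1, hi2, hj1, hj2, MSO.Sat] using inter_iff_of_ty_eq hty hi hj
  | mem i j =>
    obtain ⟨hi, hi1, hi2⟩ := hα i (by simp [MSO.fv1])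
    obtain ⟨hj, hj1, hj2⟩ := hβ j (by simp [MSO.fv2])
    simpa [hi1, hi2, hj1, hj2, MSO.Sat] using inter_iff_of_ty_eq hty hi hj
  | not φ ih => exact not_congr (ih hk hty hα hβ hγ)
  | and φ ψ ih1 ih2 =>
    simp only [MSO.qd, max_le_iff] at hk
    exact and_congr
      (ih1 hk.1 hty (fun i hi => hα i (Finset.mem_union_left _ hi))
        (fun j hj => hβ j (Finset.mem_union_left _ hj)) hγ)
      (ih2 hk.2 hty (fun i hi => hα i (Finset.mem_union_right _ hi))
        (fun j hj => hβ j (Finset.mem_union_right _ hj)) hγ)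
  | ex1 i φ ih =>
    obtain _ | k := k
    · simp [MSO.qd] at hk
    have key : ∀ a b : ℤ, ty k (m + 1) Set.univ (Function.update W m {a}) =
        ty k (m + 1) Set.univ (Function.update W' m {b}) →
        (MSO.Sat (fun x y : ℤ => x < y) P (Function.update v i a) V φ ↔
          MSO.Sat (fun x y : ℤ => x < y) P' (Function.update v' i b) V' φ) := by
      intro a b hab
      refine ih (by simpa [MSO.qd] using hk) hab (α := Function.update α i m) (β := β)
        (fun q hq => ?_) (fun j hj => ?_) (fun c => ?_)
      · rcases eq_or_ne q i with rfl | hne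
        · simp
        · obtain ⟨h1, h2, h3⟩ := hα q (by simp [MSO.fv1, hq, hne])
          simp only [Function.update_of_ne hne, Function.update_of_ne h1.ne]
          exact ⟨by omega, h2, h3⟩
      · obtain ⟨h1, h2, h3⟩ := hβ j hj
        simp only [Function.update_of_ne h1.ne]
        exact ⟨by omega, h2, h3⟩
      · obtain ⟨h1, h2, h3⟩ := hγ c
        simp only [Function.update_of_ne h1.ne]
        exact ⟨by omega, h2, h3⟩
    constructor
    · rintro ⟨a, ha⟩
      obtain ⟨b, hb⟩ := exists_ty_update_singleton_eq hty a
      exact ⟨b, (key a b hb).mp ha⟩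
    · rintro ⟨b, hb⟩
      obtain ⟨a, ha⟩ := exists_ty_update_singleton_eq hty.symm b
      exact ⟨a, (key a b ha.symm).mpr hb⟩
  | ex2 i φ ih =>
    obtain _ | k := k
    · simp [MSO.qd] at hk
    have key : ∀ A B : Set ℤ, ty k (m + 1) Set.univ (Function.update W m A) =
        ty k (m + 1) Set.univ (Function.update W' m B) →
        (MSO.Sat (fun x y : ℤ => x < y) P v (Function.update V i A) φ ↔
          MSO.Sat (fun x y : ℤ => x < y) P' v' (Function.update V' i B) φ) := by
      intro A B hAB
      refine ih (by simpa [MSO.qd] using hk) hAB (α := α) (β := Function.update β i m)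
        (fun q hq => ?_) (fun j hj => ?_) (fun c => ?_)
      · obtain ⟨h1, h2, h3⟩ := hα q hq
        simp only [Function.update_of_ne h1.ne]
        exact ⟨by omega, h2, h3⟩
      · rcases eq_or_ne j i with rfl | hne
        · simp
        · obtain ⟨h1, h2, h3⟩ := hβ j (by simp [MSO.fv2, hj, hne])
          simp only [Function.update_of_ne hne, Function.update_of_ne h1.ne]
          exact ⟨by omega, h2, h3⟩
      · obtain ⟨h1, h2, h3⟩ := hγ c
        simp only [Function.update_of_ne h1.ne]
        exact ⟨by omega, h2, h3⟩
    constructor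
    · rintro ⟨A, hA⟩
      obtain ⟨B, hB⟩ := exists_ty_update_eq hty A
      exact ⟨B, (key A B hB).mp hA⟩
    · rintro ⟨B, hB⟩
      obtain ⟨A, hA⟩ := exists_ty_update_eq hty.symm B
      exact ⟨A, (key A B hA.symm).mpr hB⟩

end Determination

/-- The sets of a labelled ordering with `m` predicates, extended by empty sets. -/
def extend {m : ℕ} (P : Fin m → Set ℤ) : ℕ → Set ℤ :=
  fun j => if h : j < m then P ⟨j, h⟩ else ∅

lemma extend_coe {m : ℕ} (P : Fin m → Set ℤ) (j : Fin m) : extend P j = P j := by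
  simp [extend]

/-- The truth of a sentence does not depend on the assignment, and is determined by the type of
the structure. -/
lemma sat_sentence_iff {m k : ℕ} {φ : MSO m} (hφ : φ.IsSentence) (hk : φ.qd ≤ k)
    {P P' : Fin m → Set ℤ}
    (h : ty k m Set.univ (extend P) = ty k m Set.univ (extend P'))
    (v v' : ℕ → ℤ) (V V' : ℕ → Set ℤ) :
    MSO.Sat (fun x y : ℤ => x < y) P v V φ ↔ MSO.Sat (fun x y : ℤ => x < y) P' v' V' φ :=
  sat_iff_of_ty_eq φ hk h (α := id) (β := id) (γ := fun a => a) (by simp [hφ.1]) (by simp [hφ.2])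
    fun a => ⟨a.2, extend_coe P a, extend_coe P' a⟩

/-! ## Words, factors and their types -/

section Words

variable {m : ℕ}

/-- The factor of the `ℤ`-word `w` at the positions of the interval `[a, b)`. -/
def factor {σ : Type} (w : ℤ → σ) (a b : ℤ) : List σ :=
  (List.range (b - a).toNat).map fun t : ℕ => w (a + (t : ℤ))

lemma length_factor {σ : Type} (w : ℤ → σ) (a b : ℤ) : (factor w a b).length = (b - a).toNat := by
  simp [factor]

lemma factor_append {σ : Type} (w : ℤ → σ) {a b c : ℤ} (hab : a ≤ b) (hbc : b ≤ c) :
    factor w a b ++ factor w b c = factor w a c := by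
  have h : (c - a).toNat = (b - a).toNat + (c - b).toNat := by omega
  rw [factor, factor, factor, h, List.range_add, List.map_append, List.map_map]
  congr 1
  refine List.map_congr_left fun t _ => ?_
  simp only [Function.comp_apply]
  congr 1
  push_cast
  omega

lemma occursAt_iff_factor {σ : Type} (w : ℤ → σ) (u : List σ) (i : ℤ) :
    OccursAt w u i ↔ factor w i (i + u.length) = u := by
  have hlen : (i + (u.length : ℤ) - i).toNat = u.length := by omega
  constructor
  · intro h
    refine List.ext_getElem (by simp [factor]) fun t h1 h2 => ?_
    simpa [factor] using h ⟨t, h2⟩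
  · intro h t
    have := List.getElem_of_eq h.symm t.2
    simpa [factor] using this.symm

lemma occursAt_factor {σ : Type} (w : ℤ → σ) {a b : ℤ} (hab : a ≤ b) :
    OccursAt w (factor w a b) a := by
  rw [occursAt_iff_factor, length_factor]
  congr 1
  omega

lemma append_factor_of_occursAt {σ : Type} {w : ℤ → σ} {u : List σ} {a b : ℤ}
    (h : OccursAt w u a) (hab : a + u.length ≤ b) :
    u ++ factor w (a + u.length) b = factor w a b := by
  rw [← factor_append w (by omega : a ≤ a + u.length) hab, (occursAt_iff_factor w u a).mp h]

lemma factor_append_of_occursAt {σ : Type} {w : ℤ → σ} {u : List σ} {a b : ℤ}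
    (h : OccursAt w u b) (hab : a ≤ b) :
    factor w a b ++ u = factor w a (b + u.length) := by
  rw [← factor_append w hab (by omega : b ≤ b + u.length), (occursAt_iff_factor w u b).mp h]

/-- The monadic type of a labelled subset of `ℤ`, with the labels given by a `ℤ`-word. -/
def wordTy (k : ℕ) (D : Set ℤ) (w : ℤ → Fin m → Prop) : Ty k m :=
  ty k m D (extend fun j => {x | w x j})

lemma wordTy_eq_of_factor_eq {k : ℕ} {w w' : ℤ → Fin m → Prop} {a b a' b' : ℤ}
    (h : factor w a b = factor w' a' b') :
    wordTy k (Set.Ico a b) w = wordTy k (Set.Ico a' b') w' := by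
  have hlen : (b - a).toNat = (b' - a').toNat := by
    rw [← length_factor w, h, length_factor]
  refine ty_translate (a' - a) (fun x => ?_) fun j hj x hx => ?_
  · simp only [Set.mem_Ico]
    omega
  · simp only [Set.mem_Ico] at hx
    have ht : (x - a).toNat < (factor w a b).length := by
      rw [length_factor]
      omega
    have hget := List.getElem_of_eq h ht
    simp only [factor, List.getElem_map, List.getElem_range] at hget
    rw [show a + ((x - a).toNat : ℤ) = x by omega,
      show a' + ((x - a).toNat : ℤ) = x + (a' - a) by omega] at hget
    simp [extend, hj, hget]

lemma ty_Ico_append {k : ℕ} {V V' : ℕ → Set ℤ} {a b c a' b' c' : ℤ} (hab : a ≤ b) (hbc : b ≤ c)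
    (hab' : a' ≤ b') (hbc' : b' ≤ c')
    (h1 : ty k m (Set.Ico a b) V = ty k m (Set.Ico a' b') V')
    (h2 : ty k m (Set.Ico b c) V = ty k m (Set.Ico b' c') V') :
    ty k m (Set.Ico a c) V = ty k m (Set.Ico a' c') V' := by
  have hmono : ∀ b : ℤ, Monotone fun x : ℤ => if x < b then (0 : ℤ) else 1 := by
    intro b x y hxy
    simp only
    split_ifs <;> omega
  have hblock : ∀ a b c : ℤ, a ≤ b → b ≤ c → ∀ i : ℤ,
      block (Set.Ico a c) (fun x => if x < b then (0 : ℤ) else 1) i =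
        if i = 0 then Set.Ico a b else if i = 1 then Set.Ico b c else ∅ := by
    intro a b c hab hbc i
    ext x
    simp only [block, Set.mem_ofPred_eq, Set.mem_Ico]
    split_ifs <;> simp <;> omega
  refine ty_sum ((hmono b).monotoneOn _) ((hmono b').monotoneOn _) fun i => ?_
  rw [hblock a b c hab hbc, hblock a' b' c' hab' hbc']
  split_ifs
  · exact h1
  · exact h2
  · exact ty_congr (by simp)

/-- The `ℤ`-word carrying the letters of the list `l` at the positions `0, …, l.length - 1`. -/
def listWord (l : List (Fin m → Prop)) : ℤ → Fin m → Prop :=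
  fun x => l.getD x.toNat fun _ => False

lemma factor_listWord_append_left (u v : List (Fin m → Prop)) :
    factor (listWord (u ++ v)) 0 u.length = u := by
  refine List.ext_getElem (by simp [factor]) fun t h1 h2 => ?_
  simp [factor, listWord, List.getElem?_append_left h2, h2]

lemma factor_listWord (u : List (Fin m → Prop)) : factor (listWord u) 0 u.length = u := by
  simpa using factor_listWord_append_left u []

lemma factor_listWord_append_right (u v : List (Fin m → Prop)) :
    factor (listWord (u ++ v)) u.length (u.length + v.length) = v := by
  refine List.ext_getElem (by simp [factor]) fun t h1 h2 => ?_
  have : ((u.length : ℤ) + t).toNat = u.length + t := by omega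
  simp [factor, listWord, this, h2]

/-- The congruence on finite words identifying words with the same monadic type of rank `k`. -/
def typeCon (k m : ℕ) : Con (FreeMonoid (Fin m → Prop)) where
  r u v := wordTy k (Set.Ico 0 (u.toList.length : ℤ)) (listWord u.toList) =
    wordTy k (Set.Ico 0 (v.toList.length : ℤ)) (listWord v.toList)
  iseqv := ⟨fun _ => rfl, fun h => h.symm, fun h h' => h.trans h'⟩
  mul' := by
    intro u u' v v' hu hv
    simp only [FreeMonoid.toList_mul, List.length_append, Nat.cast_add]
    refine ty_Ico_append (b := u.toList.length) (b' := u'.toList.length) (by omega) (by omega)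
      (by omega) (by omega) ?_ ?_
    · refine (wordTy_eq_of_factor_eq ?_).trans (hu.trans (wordTy_eq_of_factor_eq ?_))
      · rw [factor_listWord_append_left, factor_listWord]
      · rw [factor_listWord_append_left, factor_listWord]
    · refine (wordTy_eq_of_factor_eq ?_).trans (hv.trans (wordTy_eq_of_factor_eq ?_))
      · rw [factor_listWord_append_right, factor_listWord]
      · rw [factor_listWord_append_right, factor_listWord]

instance (k m : ℕ) : Finite (typeCon k m).Quotient :=
  Finite.of_injective
    (Quotient.lift (s := (typeCon k m).toSetoid) (fun u : FreeMonoid (Fin m → Prop) =>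
      wordTy k (Set.Ico 0 (u.toList.length : ℤ)) (listWord u.toList)) fun _ _ h => h)
    (by
      rintro ⟨u⟩ ⟨v⟩ h
      exact Quotient.sound (s := (typeCon k m).toSetoid) h)

/-- The class of a finite word in the monoid of types of rank `k`. -/
def typeClass (k : ℕ) (l : List (Fin m → Prop)) : (typeCon k m).Quotient :=
  ((FreeMonoid.ofList l : FreeMonoid (Fin m → Prop)) : (typeCon k m).Quotient)

lemma typeClass_append (k : ℕ) (u v : List (Fin m → Prop)) :
    typeClass k (u ++ v) = typeClass k u * typeClass k v := rfl

lemma exists_typeClass_eq {k : ℕ} (s : (typeCon k m).Quotient) :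
    ∃ l : List (Fin m → Prop), typeClass k l = s := by
  obtain ⟨l⟩ := s
  exact ⟨l.toList, rfl⟩

lemma wordTy_eq_of_typeClass_eq {k : ℕ} {w w' : ℤ → Fin m → Prop} {a b a' b' : ℤ}
    (h : typeClass k (factor w a b) = typeClass k (factor w' a' b')) :
    wordTy k (Set.Ico a b) w = wordTy k (Set.Ico a' b') w' := by
  have h' := (typeCon k m).eq.mp h
  refine (wordTy_eq_of_factor_eq ?_).trans
    (Eq.trans h' (wordTy_eq_of_factor_eq ?_))
  · exact (factor_listWord _).symm
  · exact factor_listWord _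

/-- `c` cuts the word `w` into factors of the classes `s i`. -/
def Cuts {k : ℕ} (w : ℤ → Fin m → Prop) (c : ℤ → ℤ) (s : ℤ → (typeCon k m).Quotient) : Prop :=
  StrictMono c ∧ ∀ i, typeClass k (factor w (c i) (c (i + 1))) = s i

lemma exists_block_index {c : ℤ → ℤ} (hc : StrictMono c) :
    ∃ p : ℤ → ℤ, ∀ x i, p x = i ↔ c i ≤ x ∧ x < c (i + 1) := by
  have hstep : ∀ i, c i + 1 ≤ c (i + 1) := fun i => hc (by omega)
  have hup : ∀ d : ℕ, c 0 + d ≤ c d := by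
    intro d
    induction d with
    | zero => simp
    | succ d ih =>
      have := hstep d
      push_cast
      omega
  have hdown : ∀ d : ℕ, c (-d) ≤ c 0 - d := by
    intro d
    induction d with
    | zero => simp
    | succ d ih =>
      have := hstep (-(d + 1 : ℕ))
      rw [show -((d + 1 : ℕ) : ℤ) + 1 = -d by push_cast; omega] at this
      push_cast at this ⊢
      omega
  have hex : ∀ x, ∃ i, c i ≤ x ∧ x < c (i + 1) := by
    intro x
    have hbdd : ∀ i, c i ≤ x → i ≤ (x - c 0).toNat := by
      intro i hi
      by_contra h
      have h1 := hup (x - c 0).toNat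
      have h2 := hc (not_le.mp h)
      omega
    have hinh : c (-(c 0 - x).toNat) ≤ x := by
      have := hdown (c 0 - x).toNat
      omega
    obtain ⟨i, hi, hmax⟩ := Int.exists_greatest_of_bdd (P := fun i => c i ≤ x) ⟨_, hbdd⟩ ⟨_, hinh⟩
    refine ⟨i, hi, ?_⟩
    by_contra h
    have := hmax (i + 1) (not_lt.mp h)
    omega
  choose p hp using hex
  refine ⟨p, fun x i => ⟨fun h => h ▸ hp x, fun h => ?_⟩⟩
  have h1 := hc.lt_iff_lt.mp (lt_of_le_of_lt (hp x).1 h.2)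
  have h2 := hc.lt_iff_lt.mp (lt_of_le_of_lt h.1 (hp x).2)
  omega

lemma wordTy_univ_eq_of_cuts {k : ℕ} {w w' : ℤ → Fin m → Prop} {c c' : ℤ → ℤ}
    {s : ℤ → (typeCon k m).Quotient} (h : Cuts w c s) (h' : Cuts w' c' s) :
    wordTy k Set.univ w = wordTy k Set.univ w' := by
  have hmono : ∀ {c p : ℤ → ℤ}, StrictMono c → (∀ x i, p x = i ↔ c i ≤ x ∧ x < c (i + 1)) →
      Monotone p := by
    intro c p hc hp x y hxy
    have hx := (hp x _).mp rfl
    have hy := (hp y _).mp rfl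
    have := hc.lt_iff_lt.mp (lt_of_le_of_lt hx.1 (lt_of_le_of_lt hxy hy.2))
    omega
  have hblock : ∀ {c p : ℤ → ℤ}, (∀ x i, p x = i ↔ c i ≤ x ∧ x < c (i + 1)) →
      ∀ i, block Set.univ p i = Set.Ico (c i) (c (i + 1)) := by
    intro c p hp i
    ext x
    simp [block, hp]
  obtain ⟨p, hp⟩ := exists_block_index h.1
  obtain ⟨p', hp'⟩ := exists_block_index h'.1
  refine ty_sum ((hmono h.1 hp).monotoneOn _) ((hmono h'.1 hp').monotoneOn _) fun i => ?_
  rw [hblock hp, hblock hp']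
  exact wordTy_eq_of_typeClass_eq ((h.2 i).trans (h'.2 i).symm)

/-- The bi-infinite concatenation of nonempty finite words. -/
lemma exists_concatenation {σ : Type} (U : ℤ → List σ) (hU : ∀ i, U i ≠ []) :
    ∃ (w : ℤ → σ) (c : ℤ → ℤ), StrictMono c ∧ ∀ i, factor w (c i) (c (i + 1)) = U i := by
  obtain ⟨c, hc⟩ := exists_int_chain (fun i (a b : ℤ) => b = a + (U i).length)
    (fun i a => ⟨_, rfl⟩) (fun i b => ⟨b - (U i).length, by omega⟩)
  have hmono : StrictMono c := strictMono_int_of_lt_succ fun i => by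
    have := List.length_pos_iff.mpr (hU i)
    have := hc i
    omega
  obtain ⟨p, hp⟩ := exists_block_index hmono
  have hlt : ∀ x, (x - c (p x)).toNat < (U (p x)).length := by
    intro x
    have h1 := (hp x _).mp rfl
    have h2 := hc (p x)
    omega
  refine ⟨fun x => (U (p x))[(x - c (p x)).toNat]'(hlt x), c, hmono, fun i => ?_⟩
  have hlen : (c (i + 1) - c i).toNat = (U i).length := by
    have := hc i
    omega
  refine List.ext_getElem (by rw [length_factor, hlen]) fun t h1 h2 => ?_
  have hpi : p (c i + t) = i := (hp _ _).mpr ⟨by omega, by rw [hc i]; omega⟩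
  simp only [factor, List.getElem_map, List.getElem_range, hpi]
  congr 1
  omega

/-- The classes of nonempty words. -/
def nonemptyClass (k m : ℕ) : Set (typeCon k m).Quotient := {s | ∃ l ≠ [], typeClass k l = s}

lemma mul_mem_nonemptyClass {k : ℕ} {s : (typeCon k m).Quotient} (hs : s ∈ nonemptyClass k m)
    (t : (typeCon k m).Quotient) : s * t ∈ nonemptyClass k m := by
  obtain ⟨l, hl, rfl⟩ := hs
  obtain ⟨l', rfl⟩ := exists_typeClass_eq t
  exact ⟨l ++ l', by simp [hl], typeClass_append k l l'⟩

lemma exists_cuts {k : ℕ} (s : ℤ → (typeCon k m).Quotient) (hs : ∀ i, s i ∈ nonemptyClass k m) :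
    ∃ w c, Cuts w c s := by
  choose U hU hs using hs
  obtain ⟨w, c, hc, hw⟩ := exists_concatenation U hU
  exact ⟨w, c, hc, fun i => by rw [hw, hs]⟩

/-- Shifting the cuts inside a bi-infinite product does not change its type. -/
lemma wordTy_univ_eq_of_zigzag {k : ℕ} {w w' : ℤ → Fin m → Prop} {c c' : ℤ → ℤ}
    {x y : ℤ → (typeCon k m).Quotient} (hx : ∀ i, x i ∈ nonemptyClass k m)
    (hy : ∀ i, y i ∈ nonemptyClass k m) (h : Cuts w c fun i => x i * y i)
    (h' : Cuts w' c' fun i => y i * x (i + 1)) :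
    wordTy k Set.univ w = wordTy k Set.univ w' := by
  obtain ⟨u, d, hd, hu⟩ := exists_cuts (fun i => if Even i then x (i / 2) else y (i / 2))
    (fun i => by split_ifs <;> simp [hx, hy])
  beta_reduce at hu
  have hsplit : ∀ i, typeClass k (factor u (d i) (d (i + 2))) =
      typeClass k (factor u (d i) (d (i + 1))) *
        typeClass k (factor u (d (i + 1)) (d (i + 1 + 1))) := by
    intro i
    rw [← typeClass_append, factor_append u (hd (by omega)).le (hd (by omega)).le, add_assoc]
    rfl
  have hodd : ∀ i : ℤ, ¬ Even (2 * i + 1) := fun i => by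
    rw [Int.not_even_iff_odd]
    exact ⟨i, rfl⟩
  have heven : ∀ i : ℤ, Even (2 * i) := fun i => even_two_mul i
  have hdiv : ∀ i : ℤ, (2 * i + 1) / 2 = i := fun i => by omega
  have hdiv' : ∀ i : ℤ, 2 * i / 2 = i := fun i => by omega
  have h1 : Cuts u (fun i => d (2 * i)) fun i => x i * y i := by
    refine ⟨fun i j hij => hd (by omega), fun i => ?_⟩
    have := hsplit (2 * i)
    rw [hu, hu, if_pos (heven i), if_neg (hodd i), hdiv, hdiv'] at this
    simpa only [mul_add, mul_one] using this
  have h2 : Cuts u (fun i => d (2 * i + 1)) fun i => y i * x (i + 1) := by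
    refine ⟨fun i j hij => hd (by omega), fun i => ?_⟩
    have := hsplit (2 * i + 1)
    rw [hu, hu, if_neg (hodd i), show 2 * i + 1 + 1 = 2 * (i + 1) by ring, if_pos (heven _), hdiv,
      hdiv'] at this
    rw [show 2 * i + 1 + 2 = 2 * (i + 1) + 1 by ring] at this
    exact this
  exact (wordTy_univ_eq_of_cuts h h1).trans (wordTy_univ_eq_of_cuts h2 h')

end Words

/-! ## Words recurring in both directions -/

/-- The finite word `u` occurs in `w` arbitrarily far to the left and to the right. -/
def Recurs {σ : Type} (w : ℤ → σ) (u : List σ) : Prop :=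
  ∀ N : ℤ, (∃ i ≤ N, OccursAt w u i) ∧ ∃ i ≥ N, OccursAt w u i

lemma isRegular_singleton {σ : Type} (u : List σ) : ({u} : Language σ).IsRegular := by
  refine Language.IsRegular.of_finite_range_leftQuotient ?_
  have hfin : ((fun v : List σ => ({v} : Language σ)) '' {v | v <:+ u} ∪ {0}).Finite := by
    refine Set.Finite.union (Set.Finite.image _ ?_) (Set.finite_singleton _)
    refine (List.finite_toSet u.tails).subset fun v hv => ?_
    exact (List.mem_tails _ _).mpr hv
  refine hfin.subset ?_
  rintro _ ⟨x, rfl⟩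
  by_cases hx : ∃ v, x ++ v = u
  · obtain ⟨v, rfl⟩ := hx
    refine Or.inl ⟨v, List.suffix_append x v, ?_⟩
    ext y
    change y = v ↔ x ++ y = x ++ v
    simp
  · refine Or.inr ?_
    refine Set.eq_empty_iff_forall_notMem.mpr fun y hy => hx ⟨y, ?_⟩
    exact hy

lemma Recurrent.recurs {σ : Type} {w : ℤ → σ} (hw : Recurrent w) {u : List σ}
    (hu : OccursIn w u) : Recurs w u := by
  rcases hw {u} (isRegular_singleton u) with h | h
  · exact (h u rfl hu).elim
  · intro N
    obtain ⟨⟨_, rfl, i, hi, hi'⟩, _, rfl, j, hj, hj'⟩ := h N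
    exact ⟨⟨i, by omega, hi'⟩, j, hj, hj'⟩

lemma Recurs.inEveryPrefix {σ : Type} {w : ℤ → σ} {u : List σ} (h : Recurs w u) :
    InEveryPrefix w u := by
  intro N
  obtain ⟨i, hi, hi'⟩ := (h (N - u.length)).1
  exact ⟨i, by omega, hi'⟩

lemma Recurs.inEverySuffix {σ : Type} {w : ℤ → σ} {u : List σ} (h : Recurs w u) :
    InEverySuffix w u := fun N => (h N).2

lemma recurs_of_inEvery {σ : Type} {w : ℤ → σ} {u : List σ} (h : InEveryPrefix w u)
    (h' : InEverySuffix w u) : Recurs w u := by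
  intro N
  obtain ⟨i, hi, hi'⟩ := h N
  exact ⟨⟨i, by omega, hi'⟩, h' N⟩

lemma Recurs.exists_chain {σ : Type} {w : ℤ → σ} {u : List σ} (h : Recurs w u) :
    ∃ p : ℤ → ℤ, (∀ i, OccursAt w u (p i)) ∧ ∀ i, p i + u.length ≤ p (i + 1) := by
  have : Nonempty {i // OccursAt w u i} := by
    obtain ⟨i, _, hi⟩ := (h 0).1
    exact ⟨i, hi⟩
  obtain ⟨p, hp⟩ := exists_int_chain
    (fun _ (a b : {i // OccursAt w u i}) => a.1 + u.length ≤ b.1)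
    (fun _ a => by
      obtain ⟨i, hi, hi'⟩ := (h (a.1 + u.length)).2
      exact ⟨⟨i, hi'⟩, hi⟩)
    (fun _ b => by
      obtain ⟨i, hi, hi'⟩ := (h (b.1 - u.length)).1
      exact ⟨⟨i, hi'⟩, by simp only; omega⟩)
  exact ⟨fun i => (p i).1, fun i => (p i).2, hp⟩

/-- The letterwise projection to the first `n` components. -/
def proj {n : ℕ} (f : Fin (n + 1) → Prop) : Fin n → Prop := fun k => f k.castSucc

lemma proj_surjective {n : ℕ} : Function.Surjective (proj (n := n)) := fun f =>
  ⟨Fin.snoc f True, by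
    funext k
    simp [proj]⟩

lemma proj_wordOf_snoc {n : ℕ} (P : Fin n → Set ℤ) (X : Set ℤ) (i : ℤ) :
    proj (wordOf (Fin.snoc (α := fun _ => Set ℤ) P X) i) = wordOf P i := by
  funext k
  simp [proj, wordOf]

lemma map_factor {σ τ : Type} (f : σ → τ) (w : ℤ → σ) (a b : ℤ) :
    (factor w a b).map f = factor (fun i => f (w i)) a b := by
  simp [factor, Function.comp_def]

lemma map_proj_factor {n : ℕ} (P : Fin n → Set ℤ) (X : Set ℤ) (a b : ℤ) :
    (factor (wordOf (Fin.snoc (α := fun _ => Set ℤ) P X)) a b).map proj =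
      factor (wordOf P) a b := by
  rw [map_factor]
  congr 1
  funext i
  exact proj_wordOf_snoc P X i

lemma exists_append_append_occursIn {n : ℕ} {P : Fin n → Set ℤ} (hrec : Recurrent (wordOf P))
    {l : List (Fin (n + 1) → Prop)} (hl : OccursIn (wordOf P) (l.map proj)) :
    ∃ r : List (Fin (n + 1) → Prop), OccursIn (wordOf P) ((l ++ r ++ l).map proj) := by
  obtain ⟨p, hp, hp'⟩ := (hrec.recurs hl).exists_chain
  obtain ⟨r, hr⟩ := List.map_surjective_iff.mpr proj_surjective
    (factor (wordOf P) (p 0 + (l.map proj).length) (p 1))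
  refine ⟨r, p 0, ?_⟩
  have hle : p 0 + (l.map proj).length ≤ p 1 := hp' 0
  have : (l ++ r ++ l).map proj =
      factor (wordOf P) (p 0) (p 1 + (l.map proj).length) := by
    rw [List.map_append, List.map_append, hr, append_factor_of_occursAt (hp 0) hle,
      factor_append_of_occursAt (hp 1) (by omega)]
  rw [this]
  exact occursAt_factor _ (by omega)

/-- For every rank `k` some finite word compatible with a recurrent `M` determines, by recurring
in both directions, the type of rank `k` of an expansion of `M` by one predicate. -/
theorem exists_determining_word {n : ℕ} {P : Fin n → Set ℤ} (hrec : Recurrent (wordOf P))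
    (k : ℕ) : ∃ Z : List (Fin (n + 1) → Prop), OccursIn (wordOf P) (Z.map proj) ∧
      ∃ τ : Ty k (n + 1), ∀ X : Set ℤ,
        Recurs (wordOf (Fin.snoc (α := fun _ => Set ℤ) P X)) Z →
        ty k (n + 1) Set.univ (extend (Fin.snoc (α := fun _ => Set ℤ) P X)) = τ := by
  let F : Set (typeCon k (n + 1)).Quotient :=
    {s | ∃ l ≠ [], OccursIn (wordOf P) (l.map proj) ∧ typeClass k l = s}
  have hne : F.Nonempty := by
    obtain ⟨f, hf⟩ := proj_surjective (wordOf P 0)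
    refine ⟨_, [f], by simp, ⟨0, fun t => ?_⟩, rfl⟩
    simp [hf]
  have hconn : ∀ z ∈ F, ∃ r, z * r * z ∈ F := by
    rintro _ ⟨l, hl, hocc, rfl⟩
    obtain ⟨r, hr⟩ := exists_append_append_occursIn hrec hocc
    exact ⟨typeClass k r, l ++ r ++ l, by simp [hl], hr, rfl⟩
  obtain ⟨z, ⟨Z, hZ, hocc, rfl⟩, ⟨t, he, hez⟩, hmin⟩ := exists_minimal_factor F hne hconn
  set z := typeClass k Z with hz
  set e := z * t with hedef
  have hzne : z ∈ nonemptyClass k (n + 1) := ⟨Z, hZ, rfl⟩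
  have hene : ∀ x, e * x = x → x ∈ nonemptyClass k (n + 1) := fun x hx =>
    hx ▸ mul_mem_nonemptyClass (mul_mem_nonemptyClass hzne t) x
  obtain ⟨w₀, c₀, hw₀⟩ := exists_cuts (fun _ => e) (fun _ => hene e he)
  refine ⟨Z, hocc, wordTy k Set.univ w₀, fun X hX => ?_⟩
  obtain ⟨p, hp, hp'⟩ := hX.exists_chain
  set w := wordOf (Fin.snoc (α := fun _ => Set ℤ) P X) with hw
  have hlen : 0 < Z.length := List.length_pos_iff.mpr hZ
  let s : ℤ → (typeCon k (n + 1)).Quotient := fun i => typeClass k (factor w (p i) (p (i + 1)))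
  have hs : ∀ i, ∃ r, s i = z * r := by
    intro i
    refine ⟨typeClass k (factor w (p i + Z.length) (p (i + 1))), ?_⟩
    rw [hz, ← typeClass_append, append_factor_of_occursAt (hp i) (hp' i)]
  have hsz : ∀ i, s i * z ∈ F := by
    intro i
    have hfac : factor w (p i) (p (i + 1)) ++ Z = factor w (p i) (p (i + 1) + Z.length) := by
      have := hp' i
      exact factor_append_of_occursAt (hp (i + 1)) (by omega)
    refine ⟨factor w (p i) (p (i + 1)) ++ Z, by simp [hZ], ⟨p i, ?_⟩, rfl⟩
    rw [hfac, hw, map_proj_factor]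
    have := hp' i
    exact occursAt_factor _ (by omega)
  have hinv : ∀ i, ∃ c, s i * z * c = z := by
    intro i
    obtain ⟨r, hr⟩ := hs i
    have := hmin r (hr ▸ hsz i)
    rwa [← hr] at this
  choose c hc using hinv
  have hes : ∀ i, e * s i = s i := by
    intro i
    obtain ⟨r, hr⟩ := hs i
    rw [hr, ← mul_assoc, hez]
  obtain ⟨x, y, hx, hy, hxy, hyx⟩ := exists_zigzag he s (fun i => z * c i * t * e) hes
    (fun i => by simp only [← mul_assoc, hez]) (fun i => by rw [mul_assoc, he])
    (fun i => by
      calc s i * e * (z * c i * t * e) = s i * (e * z) * c i * t * e := by simp only [mul_assoc]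
        _ = e := by rw [hez, hc, ← hedef, he])
  refine wordTy_univ_eq_of_zigzag (w := w) (c := p) (fun i => hene _ (hx i))
    (fun i => hene _ (hy i)) ⟨strictMono_int_of_lt_succ fun i => ?_, fun i => ?_⟩
    (w' := w₀) (c' := c₀) ⟨hw₀.1, fun i => ?_⟩
  · have := hp' i
    omega
  · exact (hxy i).symm
  · exact (hw₀.2 i).trans (hyx i).symm

/-- A set all of whose compatible words recur is not definable. -/
theorem not_definable_of_recurs {n : ℕ} {P : Fin n → Set ℤ} {Q : Set ℤ}
    (hrec : Recurrent (wordOf P))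
    (hQ : ∀ Z : List (Fin (n + 1) → Prop), OccursIn (wordOf P) (Z.map proj) →
      Recurs (wordOf (Fin.snoc (α := fun _ => Set ℤ) P Q)) Z) :
    ¬ MSO.Definable (fun x y : ℤ => x < y) P Q := by
  rintro ⟨φ, hφ1, hφ2, hφ⟩
  obtain ⟨Z, hZ, τ, hτ⟩ := exists_determining_word hrec (φ.qd + 1)
  have hZQ := hQ Z hZ
  let X : Set ℤ := {x | if x = 0 then x ∉ Q else x ∈ Q}
  have hword : ∀ x ≠ 0, wordOf (Fin.snoc (α := fun _ => Set ℤ) P X) x =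
      wordOf (Fin.snoc (α := fun _ => Set ℤ) P Q) x := by
    intro x hx
    funext j
    refine Fin.lastCases ?_ (fun j => ?_) j <;> simp [wordOf, X, hx]
  have hoccX : ∀ i : ℤ, (0 < i ∨ i + Z.length ≤ 0) →
      OccursAt (wordOf (Fin.snoc (α := fun _ => Set ℤ) P Q)) Z i →
      OccursAt (wordOf (Fin.snoc (α := fun _ => Set ℤ) P X)) Z i := by
    intro i hi h t
    rw [hword _ (by have := t.2; omega)]
    exact h t
  have hZX : Recurs (wordOf (Fin.snoc (α := fun _ => Set ℤ) P X)) Z := by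
    intro N
    obtain ⟨i, hi, hi'⟩ := (hZQ (min N (-Z.length))).1
    obtain ⟨j, hj, hj'⟩ := (hZQ (max N 1)).2
    exact ⟨⟨i, by omega, hoccX i (by omega) hi'⟩, j, by omega, hoccX j (by omega) hj'⟩
  have hsat : ∀ a b : ℤ,
      ty φ.qd (n + 1 + 1) Set.univ
        (Function.update (extend (Fin.snoc (α := fun _ => Set ℤ) P X)) (n + 1) {a}) =
      ty φ.qd (n + 1 + 1) Set.univ
        (Function.update (extend (Fin.snoc (α := fun _ => Set ℤ) P Q)) (n + 1) {b}) →
      (a ∈ Q ↔ b ∈ Q) ∧ (a ∈ X ↔ b ∈ Q) := by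
    intro a b hab
    constructor
    · rw [hφ, hφ]
      have key : ∀ v V v' V', MSO.Sat (fun x y : ℤ => x < y) P (Function.update v 0 a) V φ ↔
          MSO.Sat (fun x y : ℤ => x < y) P (Function.update v' 0 b) V' φ := by
        intro v V v' V'
        refine sat_iff_of_ty_eq φ le_rfl hab (α := fun _ => n + 1) (β := id)
          (γ := fun j => (j.castSucc : Fin (n + 1))) (fun i hi => ?_) (by simp [hφ2]) fun j => ?_
        · obtain rfl : i = 0 := by simpa using hφ1 hi
          simp
        · have hne : (j.castSucc : Fin (n + 1)).val ≠ n + 1 := (j.castSucc).2.ne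
          have hlt : (j.castSucc : Fin (n + 1)).val < n + 1 := (j.castSucc).2
          simp only [Function.update_of_ne hne, extend_coe, Fin.snoc_castSucc]
          exact ⟨by omega, trivial, trivial⟩
      exact ⟨fun h v V => (key v V v V).mp (h v V), fun h v V => (key v V v V).mpr (h v V)⟩
    · have hn : extend (Fin.snoc (α := fun _ => Set ℤ) P X) n = X := by
        have := extend_coe (Fin.snoc (α := fun _ => Set ℤ) P X) (Fin.last n)
        rwa [Fin.snoc_last] at this
      have hn' : extend (Fin.snoc (α := fun _ => Set ℤ) P Q) n = Q := by
        have := extend_coe (Fin.snoc (α := fun _ => Set ℤ) P Q) (Fin.last n)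
        rwa [Fin.snoc_last] at this
      have := inter_iff_of_ty_eq hab (i := n + 1) (j := n) (by omega) (by omega)
      simpa [hn, hn'] using this
  obtain ⟨b, hb⟩ := exists_ty_update_singleton_eq ((hτ X hZX).trans (hτ Q hZQ).symm) 0
  obtain ⟨h1, h2⟩ := hsat 0 b hb
  have h3 : (0 : ℤ) ∈ X ↔ (0 : ℤ) ∉ Q := by simp [X]
  tauto

/-! ## Reducing truth in an expansion to truth in the structure -/

namespace MSO

variable {n : ℕ}

/-- Replace the last predicate by the set variable `0`, shifting the other set variables. -/
def absorb : MSO (n + 1) → MSO n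
  | lt i j => lt i j
  | pred k i => if h : (k : ℕ) < n then pred ⟨k, h⟩ i else mem i 0
  | mem i j => mem i (j + 1)
  | not φ => not (absorb φ)
  | and φ ψ => and (absorb φ) (absorb ψ)
  | ex1 i φ => ex1 i (absorb φ)
  | ex2 j φ => ex2 (j + 1) (absorb φ)

lemma sat_absorb (P : Fin n → Set ℤ) (φ : MSO (n + 1)) (v : ℕ → ℤ) (V : ℕ → Set ℤ) :
    Sat (fun x y : ℤ => x < y) P v V (absorb φ) ↔
      Sat (fun x y : ℤ => x < y) (Fin.snoc (α := fun _ => Set ℤ) P (V 0)) v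
        (fun j => V (j + 1)) φ := by
  induction φ generalizing v V with
  | lt i j => rfl
  | pred k i =>
    refine Fin.lastCases ?_ (fun k => ?_) k <;> simp [absorb, Sat]
  | mem i j => rfl
  | not φ ih => exact not_congr (ih v V)
  | and φ ψ ih1 ih2 => exact and_congr (ih1 v V) (ih2 v V)
  | ex1 i φ ih => exact exists_congr fun a => ih _ _
  | ex2 j φ ih =>
    refine exists_congr fun S => ?_
    rw [ih]
    have : (fun i => Function.update V (j + 1) S (i + 1)) =
        Function.update (fun i => V (i + 1)) j S := by
      funext i
      simp [Function.update_apply]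
    rw [this, Function.update_of_ne (by omega)]

lemma fv1_absorb (φ : MSO (n + 1)) : fv1 (absorb φ) = fv1 φ := by
  induction φ with
  | pred k i =>
    simp only [absorb]
    split_ifs <;> rfl
  | _ => simp_all [absorb, fv1]

lemma succ_mem_fv2_absorb (φ : MSO (n + 1)) (j : ℕ) : j + 1 ∈ fv2 (absorb φ) ↔ j ∈ fv2 φ := by
  induction φ with
  | pred k i =>
    simp only [absorb]
    split_ifs <;> simp [fv2]
  | _ => simp_all [absorb, fv2]

lemma isSentence_iff_absorb (φ : MSO (n + 1)) :
    IsSentence φ ↔ fv1 (absorb φ) = ∅ ∧ fv2 (absorb φ) ⊆ {0} := by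
  rw [IsSentence, fv1_absorb]
  refine and_congr_right fun _ => ⟨fun h j hj => ?_, fun h => ?_⟩
  · obtain _ | j := j
    · simp
    · simp [succ_mem_fv2_absorb, h] at hj
  · refine Finset.eq_empty_of_forall_notMem fun j hj => ?_
    simpa using h ((succ_mem_fv2_absorb φ j).mpr hj)

lemma exists_label (f : Fin (n + 1) → Prop) :
    ∃ χ : MSO n, fv1 χ ⊆ {0} ∧ fv2 χ ⊆ {0} ∧ ∀ (P : Fin n → Set ℤ) v V,
      Sat (fun x y : ℤ => x < y) P v V χ ↔
        wordOf (Fin.snoc (α := fun _ => Set ℤ) P (V 0)) (v 0) = f := by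
  have hatom : ∀ k : Fin (n + 1), fv1 (absorb (pred k 0)) ⊆ {0} ∧
      fv2 (absorb (pred k 0)) ⊆ {0} := by
    intro k
    simp only [absorb]
    split_ifs <;> simp [fv1, fv2]
  have hind : ∀ s : Finset (Fin (n + 1)), ∃ χ : MSO n, fv1 χ ⊆ {0} ∧ fv2 χ ⊆ {0} ∧
      ∀ (P : Fin n → Set ℤ) v V, Sat (fun x y : ℤ => x < y) P v V χ ↔
        ∀ k ∈ s, (wordOf (Fin.snoc (α := fun _ => Set ℤ) P (V 0)) (v 0) k ↔ f k) := by
    intro s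
    induction s using Finset.induction_on with
    | empty => exact ⟨not (lt 0 0), by simp [fv1], by simp [fv2], by simp [Sat]⟩
    | insert k s _ ih =>
      obtain ⟨χ, h1, h2, h3⟩ := ih
      by_cases hf : f k
      · refine ⟨and (absorb (pred k 0)) χ, Finset.union_subset (hatom k).1 h1,
          Finset.union_subset (hatom k).2 h2, fun P v V => ?_⟩
        simp [Sat, sat_absorb, h3, hf, wordOf]
      · refine ⟨and (not (absorb (pred k 0))) χ, Finset.union_subset (hatom k).1 h1,
          Finset.union_subset (hatom k).2 h2, fun P v V => ?_⟩
        simp [Sat, sat_absorb, h3, hf, wordOf]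
  obtain ⟨χ, h1, h2, h3⟩ := hind Finset.univ
  refine ⟨χ, h1, h2, fun P v V => ?_⟩
  rw [h3, funext_iff]
  simp

/-- The variable `1` denotes the successor of the variable `0`. -/
def isSucc : MSO n := and (lt 0 1) (not (ex1 2 (and (lt 0 2) (lt 2 1))))

/-- The variables `0` and `1` denote the same element. -/
def isEq : MSO n := and (not (lt 0 1)) (not (lt 1 0))

lemma sat_isSucc (P : Fin n → Set ℤ) (v : ℕ → ℤ) (V : ℕ → Set ℤ) :
    Sat (fun x y : ℤ => x < y) P v V isSucc ↔ v 1 = v 0 + 1 := by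
  simp only [isSucc, Sat, Function.update_self, not_exists, not_and, not_lt,
    Function.update_of_ne (show (0 : ℕ) ≠ 2 by omega),
    Function.update_of_ne (show (1 : ℕ) ≠ 2 by omega)]
  constructor
  · rintro ⟨h1, h2⟩
    have := h2 (v 0 + 1)
    omega
  · intro h
    exact ⟨by omega, fun a ha => by omega⟩

lemma sat_isEq (P : Fin n → Set ℤ) (v : ℕ → ℤ) (V : ℕ → Set ℤ) :
    Sat (fun x y : ℤ => x < y) P v V isEq ↔ v 0 = v 1 := by
  simp only [isEq, Sat]
  omega

variable {ι : Type} (lab : ι → MSO n)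

/-- The word `l` occurs at the variable `0`, where `lab a` says that the letter at the variable
`0` is `a`. -/
def occ : List ι → MSO n
  | [] => not (lt 0 0)
  | a :: l => and (lab a) (ex1 1 (and isSucc (ex1 0 (and isEq (occ l)))))

/-- The word `l` occurs arbitrarily far to the left and to the right. -/
def recOcc (l : List ι) : MSO n :=
  not (ex1 1 (not (and (ex1 0 (and (not (lt 1 0)) (occ lab l)))
    (ex1 0 (and (not (lt 0 1)) (occ lab l))))))

/-- The word `l` occurs for some value of the set variable `0`, and whenever it recurs in both
directions, `φ` holds. -/
def query (φ : MSO (n + 1)) (l : List ι) : MSO n :=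
  and (ex2 0 (ex1 0 (occ lab l))) (not (ex2 0 (and (recOcc lab l) (not (absorb φ)))))

/-- A formula that is a tautology, and a sentence if and only if `φ` is. -/
def taut (φ : MSO (n + 1)) : MSO n := ex2 0 (not (and (absorb φ) (not (absorb φ))))

variable {lab}

lemma fv1_occ (hlab : ∀ a, fv1 (lab a) ⊆ {0}) (l : List ι) : fv1 (occ lab l) ⊆ {0} := by
  induction l with
  | nil => simp [occ, fv1]
  | cons a l ih =>
    intro x hx
    have h1 := @hlab a x
    have h2 := @ih x
    simp only [occ, isSucc, isEq, fv1, Finset.mem_union, Finset.mem_sdiff, Finset.mem_insert,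
      Finset.mem_singleton] at *
    tauto

lemma fv2_occ (hlab : ∀ a, fv2 (lab a) ⊆ {0}) (l : List ι) : fv2 (occ lab l) ⊆ {0} := by
  induction l with
  | nil => simp [occ, fv2]
  | cons a l ih =>
    simp only [occ, isSucc, isEq, fv2, Finset.union_empty, Finset.empty_union]
    exact Finset.union_subset (hlab a) ih

lemma isSentence_query (h1 : ∀ a, fv1 (lab a) ⊆ {0}) (h2 : ∀ a, fv2 (lab a) ⊆ {0})
    {φ : MSO (n + 1)} (hφ : IsSentence φ) (l : List ι) : IsSentence (query lab φ l) := by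
  have h1' := fv1_occ h1 l
  have h2' := fv2_occ h2 l
  obtain ⟨h3, h4⟩ := (isSentence_iff_absorb φ).mp hφ
  constructor
  · refine Finset.eq_empty_of_forall_notMem fun x hx => ?_
    have h5 := @h1' x
    simp only [query, recOcc, fv1, Finset.mem_union, Finset.mem_sdiff, Finset.mem_insert,
      Finset.mem_singleton, h3, Finset.notMem_empty] at *
    tauto
  · refine Finset.eq_empty_of_forall_notMem fun x hx => ?_
    have h5 := @h2' x
    have h6 := @h4 x
    simp only [query, recOcc, fv2, Finset.mem_union, Finset.mem_sdiff,
      Finset.mem_singleton, Finset.notMem_empty] at *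
    tauto

lemma isSentence_taut_iff (φ : MSO (n + 1)) : IsSentence (taut φ) ↔ IsSentence φ := by
  rw [isSentence_iff_absorb]
  simp [IsSentence, taut, fv1, fv2, Finset.sdiff_eq_empty_iff_subset]

lemma trueIn_taut (P : Fin n → Set ℤ) (φ : MSO (n + 1)) :
    TrueIn (fun x y : ℤ => x < y) P (taut φ) := fun _ _ => ⟨∅, fun h => h.2 h.1⟩

lemma occursAt_cons {σ : Type} (w : ℤ → σ) (a : σ) (l : List σ) (i : ℤ) :
    OccursAt w (a :: l) i ↔ w i = a ∧ OccursAt w l (i + 1) := by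
  constructor
  · intro h
    refine ⟨by simpa using h ⟨0, by simp⟩, fun t => ?_⟩
    have := h ⟨t + 1, by simp⟩
    simp only [Nat.cast_add, Nat.cast_one, List.get_eq_getElem, List.getElem_cons_succ] at this
    rw [add_assoc, add_comm 1]
    exact this
  · rintro ⟨h1, h2⟩ ⟨t, ht⟩
    obtain _ | t := t
    · simpa using h1
    · have := h2 ⟨t, by simpa using ht⟩
      rw [add_assoc, add_comm 1] at this
      simpa using this

/-- `lab a` says that the letter at the variable `0` is `e a`, where the set variable `0` stands
for the last predicate. -/
def IsLabelling (lab : ι → MSO n) (e : ι → Fin (n + 1) → Prop) : Prop :=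
  ∀ a (P : Fin n → Set ℤ) v V, Sat (fun x y : ℤ => x < y) P v V (lab a) ↔
    wordOf (Fin.snoc (α := fun _ => Set ℤ) P (V 0)) (v 0) = e a

variable {e : ι → Fin (n + 1) → Prop}

lemma sat_occ (hlab : IsLabelling lab e) (P : Fin n → Set ℤ) (l : List ι) (v : ℕ → ℤ) (V : ℕ → Set ℤ) :
    Sat (fun x y : ℤ => x < y) P v V (occ lab l) ↔
      OccursAt (wordOf (Fin.snoc (α := fun _ => Set ℤ) P (V 0))) (l.map e) (v 0) := by
  induction l generalizing v with
  | nil =>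
    simp only [occ, Sat, lt_irrefl, not_false_eq_true, true_iff, List.map_nil]
    exact fun t => t.elim0
  | cons a l ih =>
    simp only [occ, Sat, hlab a P, sat_isSucc, sat_isEq, ih, Function.update_self, List.map_cons,
      occursAt_cons, Function.update_of_ne (show (1 : ℕ) ≠ 0 by omega),
      Function.update_of_ne (show (0 : ℕ) ≠ 1 by omega), exists_eq_left]

lemma sat_recOcc (hlab : IsLabelling lab e) (P : Fin n → Set ℤ) (l : List ι) (v : ℕ → ℤ) (V : ℕ → Set ℤ) :
    Sat (fun x y : ℤ => x < y) P v V (recOcc lab l) ↔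
      Recurs (wordOf (Fin.snoc (α := fun _ => Set ℤ) P (V 0))) (l.map e) := by
  simp only [recOcc, Sat, sat_occ hlab, Function.update_self,
    Function.update_of_ne (show (1 : ℕ) ≠ 0 by omega), not_lt, not_exists, not_not, Recurs,
    ge_iff_le]

lemma sat_query (hlab : IsLabelling lab e) (P : Fin n → Set ℤ) {φ : MSO (n + 1)} (hφ : IsSentence φ) (l : List ι)
    (v : ℕ → ℤ) (V : ℕ → Set ℤ) :
    Sat (fun x y : ℤ => x < y) P v V (query lab φ l) ↔
      (∃ X : Set ℤ, OccursIn (wordOf (Fin.snoc (α := fun _ => Set ℤ) P X)) (l.map e)) ∧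
      ∀ X : Set ℤ, Recurs (wordOf (Fin.snoc (α := fun _ => Set ℤ) P X)) (l.map e) →
        TrueIn (fun x y : ℤ => x < y) (Fin.snoc (α := fun _ => Set ℤ) P X) φ := by
  have htrue : ∀ (X : Set ℤ) (V' : ℕ → Set ℤ),
      Sat (fun x y : ℤ => x < y) (Fin.snoc (α := fun _ => Set ℤ) P X) v V' φ ↔
      TrueIn (fun x y : ℤ => x < y) (Fin.snoc (α := fun _ => Set ℤ) P X) φ := fun X V' =>
    ⟨fun h v₁ V₁ => (sat_sentence_iff hφ le_rfl rfl _ _ _ _).mp h, fun h => h _ _⟩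
  simp only [query, Sat, sat_occ hlab, sat_recOcc hlab, sat_absorb, Function.update_self, htrue,
    not_exists, not_and, not_not, OccursIn]

/-- Truth of a sentence in a generic expansion is equivalent to the truth of some query. -/
theorem trueIn_snoc_iff_exists_query {P : Fin n → Set ℤ} {Q : Set ℤ}
    (hlab : IsLabelling lab e) (he : Function.Surjective e) (hrec : Recurrent (wordOf P))
    (hQ : ∀ Z : List (Fin (n + 1) → Prop), OccursIn (wordOf P) (Z.map proj) →
      Recurs (wordOf (Fin.snoc (α := fun _ => Set ℤ) P Q)) Z)
    {φ : MSO (n + 1)} (hφ : IsSentence φ) :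
    TrueIn (fun x y : ℤ => x < y) (Fin.snoc (α := fun _ => Set ℤ) P Q) φ ↔
      ∃ l, TrueIn (fun x y : ℤ => x < y) P (query lab φ l) := by
  constructor
  · intro h
    obtain ⟨Z, hZ, τ, hτ⟩ := exists_determining_word hrec φ.qd
    obtain ⟨l, rfl⟩ := List.map_surjective_iff.mpr he Z
    refine ⟨l, fun v V => (sat_query hlab P hφ l v V).mpr ⟨⟨Q, ?_⟩, fun X hX v' V' => ?_⟩⟩
    · obtain ⟨i, _, hi⟩ := (hQ _ hZ 0).1
      exact ⟨i, hi⟩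
    · exact (sat_sentence_iff hφ le_rfl ((hτ X hX).trans (hτ Q (hQ _ hZ)).symm) _ _ _ _).mpr
        (h v' V')
  · rintro ⟨l, hl⟩
    obtain ⟨⟨X, i, hi⟩, hX⟩ := (sat_query hlab P hφ l (fun _ => 0) (fun _ => ∅)).mp (hl _ _)
    refine hX Q (hQ _ ⟨i, ?_⟩)
    rw [← (occursAt_iff_factor _ _ _).mp hi, map_proj_factor]
    exact occursAt_factor _ (by omega)

end MSO

namespace MSO

variable {n : ℕ}

lemma encode_injective : Function.Injective (encode (n := n)) := by
  intro φ ψ h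
  induction φ generalizing ψ with
  | lt i j => cases ψ <;> simp [encode, Nat.pair_eq_pair] at h ⊢; exact h
  | pred k i => cases ψ <;> simp [encode, Nat.pair_eq_pair, ← Fin.ext_iff] at h ⊢; exact h
  | mem i j => cases ψ <;> simp [encode, Nat.pair_eq_pair] at h ⊢; exact h
  | not φ ih => cases ψ <;> simp [encode, Nat.pair_eq_pair] at h ⊢; exact ih h
  | and φ φ' ih1 ih2 =>
    cases ψ <;> simp [encode, Nat.pair_eq_pair] at h ⊢
    exact ⟨ih1 h.1, ih2 h.2⟩
  | ex1 i φ ih => cases ψ <;> simp [encode, Nat.pair_eq_pair] at h ⊢; exact ⟨h.1, ih h.2⟩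
  | ex2 i φ ih => cases ψ <;> simp [encode, Nat.pair_eq_pair] at h ⊢; exact ⟨h.1, ih h.2⟩

lemma encode_mem_theoryCodes {P : Fin n → Set ℤ} {φ : MSO n} (hφ : IsSentence φ) :
    encode φ ∈ TheoryCodes (fun x y : ℤ => x < y) P ↔ TrueIn (fun x y : ℤ => x < y) P φ := by
  constructor
  · rintro ⟨ψ, _, h, hψ⟩
    rwa [← encode_injective h]
  · exact fun h => ⟨φ, hφ, rfl, h⟩

/-- One step of the recursion computing `absorb` on codes; `F` gives the values at smaller
codes. -/
def absorbStep (n c : ℕ) (F : ℕ → ℕ) : ℕ :=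
  let x := c.unpair.2
  if c.unpair.1 = 1 then
    if x.unpair.1 = n then Nat.pair 2 (Nat.pair x.unpair.2 0) else c
  else if c.unpair.1 = 2 then Nat.pair 2 (Nat.pair x.unpair.1 (x.unpair.2 + 1))
  else if c.unpair.1 = 3 then Nat.pair 3 (F x)
  else if c.unpair.1 = 4 then Nat.pair 4 (Nat.pair (F x.unpair.1) (F x.unpair.2))
  else if c.unpair.1 = 5 then Nat.pair 5 (Nat.pair x.unpair.1 (F x.unpair.2))
  else if c.unpair.1 = 6 then Nat.pair 6 (Nat.pair (x.unpair.1 + 1) (F x.unpair.2))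
  else c

lemma absorbStep_congr (n c : ℕ) {F F' : ℕ → ℕ} (h : ∀ d < c, F d = F' d) :
    absorbStep n c F = absorbStep n c F' := by
  have h1 : c.unpair.1 ≠ 0 → c.unpair.2 < c := by
    intro h0
    have := Nat.add_le_pair c.unpair.1 c.unpair.2
    rw [Nat.pair_unpair] at this
    omega
  have h2 := Nat.unpair_left_le c.unpair.2
  have h3 := Nat.unpair_right_le c.unpair.2
  simp only [absorbStep]
  split_ifs with h4 h5 h6 h7 h8 h9 h10
  · rfl
  · rfl
  · rfl
  · rw [h _ (h1 (by omega))]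
  · have := h1 (by omega)
    rw [h _ (by omega), h _ (by omega)]
  · have := h1 (by omega)
    rw [h _ (by omega)]
  · have := h1 (by omega)
    rw [h _ (by omega)]
  · rfl

/-- The function `absorb` on codes. -/
def absorbCode (n : ℕ) (c : ℕ) : ℕ :=
  absorbStep n c fun d => if d < c then absorbCode n d else 0

lemma absorbCode_eq (n c : ℕ) : absorbCode n c = absorbStep n c (absorbCode n) := by
  rw [absorbCode]
  exact absorbStep_congr n c fun d hd => if_pos hd

lemma absorbCode_encode (φ : MSO (n + 1)) : absorbCode n (encode φ) = encode (absorb φ) := by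
  induction φ with
  | pred k i =>
    rw [absorbCode_eq]
    refine Fin.lastCases ?_ (fun k => ?_) k
    · simp [absorbStep, encode, absorb]
    · simp [absorbStep, encode, absorb, k.2.ne]
  | _ =>
    rw [absorbCode_eq]
    simp_all [absorbStep, encode, absorb]

lemma exists_of_absorbCode_eq (χ : MSO n) (c : ℕ) (h : absorbCode n c = encode χ) :
    ∃ φ, encode φ = c ∧ absorb φ = χ := by
  induction χ generalizing c with
  | lt i j =>
    rw [absorbCode_eq] at h
    simp only [absorbStep, encode] at h
    split_ifs at h <;> simp_all [Nat.pair_eq_pair]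
    exact ⟨lt i j, rfl, rfl⟩
  | pred k i =>
    rw [absorbCode_eq] at h
    simp only [absorbStep, encode] at h
    split_ifs at h <;> simp_all [Nat.pair_eq_pair]
    exact ⟨pred k.castSucc i, rfl, by simp [absorb]⟩
  | mem i j =>
    rw [absorbCode_eq] at h
    simp only [absorbStep, encode] at h
    split_ifs at h with h1 h2 h3 <;> simp_all [Nat.pair_eq_pair]
    · refine ⟨pred (Fin.last n) i, ?_, by simp [absorb, h]⟩
      rw [← Nat.pair_unpair c, h1, ← Nat.pair_unpair c.unpair.2, h2, h.1]
      simp [encode]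
    · refine ⟨mem i c.unpair.2.unpair.2, ?_, by simp [absorb, h]⟩
      rw [encode, ← h.1, Nat.pair_unpair, ← h3, Nat.pair_unpair]
  | not χ ih =>
    rw [absorbCode_eq] at h
    simp only [absorbStep, encode] at h
    split_ifs at h with h1 h2 h3 h4 <;> simp_all [Nat.pair_eq_pair]
    obtain ⟨φ, hφ, rfl⟩ := ih _ h
    refine ⟨not φ, ?_, rfl⟩
    rw [encode, hφ, ← h4, Nat.pair_unpair]
  | and χ χ' ih1 ih2 =>
    rw [absorbCode_eq] at h
    simp only [absorbStep, encode] at h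
    split_ifs at h with h1 h2 h3 h4 h5 <;> simp_all [Nat.pair_eq_pair]
    obtain ⟨φ, hφ, rfl⟩ := ih1 _ h.1
    obtain ⟨ψ, hψ, rfl⟩ := ih2 _ h.2
    refine ⟨and φ ψ, ?_, rfl⟩
    rw [encode, hφ, hψ, Nat.pair_unpair, ← h5, Nat.pair_unpair]
  | ex1 i χ ih =>
    rw [absorbCode_eq] at h
    simp only [absorbStep, encode] at h
    split_ifs at h with h1 h2 h3 h4 h5 h6 <;> simp_all [Nat.pair_eq_pair]
    obtain ⟨φ, hφ, rfl⟩ := ih _ h.2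
    refine ⟨ex1 i φ, ?_, rfl⟩
    rw [encode, hφ, ← h.1, Nat.pair_unpair, ← h6, Nat.pair_unpair]
  | ex2 i χ ih =>
    rw [absorbCode_eq] at h
    simp only [absorbStep, encode] at h
    split_ifs at h with h1 h2 h3 h4 h5 h6 h7 <;> simp_all [Nat.pair_eq_pair]
    obtain ⟨φ, hφ, rfl⟩ := ih _ h.2
    refine ⟨ex2 c.unpair.2.unpair.1 φ, ?_, by simp [absorb, h.1]⟩
    rw [encode, hφ, Nat.pair_unpair, ← h7, Nat.pair_unpair]

lemma primrec_absorbCode (n : ℕ) : Primrec (absorbCode n) := by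
  have hnum : ∀ k : ℕ, Primrec fun l : List ℕ => k := fun k => Primrec.const k
  have hc : Primrec fun l : List ℕ => l.length := Primrec.list_length
  have ht : Primrec fun l : List ℕ => l.length.unpair.1 := Primrec.fst.comp (Primrec.unpair.comp hc)
  have hx : Primrec fun l : List ℕ => l.length.unpair.2 := Primrec.snd.comp (Primrec.unpair.comp hc)
  have hx1 : Primrec fun l : List ℕ => l.length.unpair.2.unpair.1 :=
    Primrec.fst.comp (Primrec.unpair.comp hx)
  have hx2 : Primrec fun l : List ℕ => l.length.unpair.2.unpair.2 :=
    Primrec.snd.comp (Primrec.unpair.comp hx)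
  have hF : ∀ {f : List ℕ → ℕ}, Primrec f → Primrec fun l : List ℕ => l.getD (f l) 0 :=
    fun hf => (Primrec.list_getD 0).comp Primrec.id hf
  have hp : ∀ {f g : List ℕ → ℕ}, Primrec f → Primrec g → Primrec fun l => Nat.pair (f l) (g l) :=
    fun hf hg => Primrec₂.natPair.comp hf hg
  have hite : ∀ (k : ℕ) {f g h : List ℕ → ℕ}, Primrec f → Primrec g → Primrec h →
      Primrec fun l => if f l = k then g l else h l :=
    fun k f g h hf hg hh => Primrec.ite (Primrec.eq.comp hf (hnum k)) hg hh
  have hstep : Primrec fun l : List ℕ => absorbStep n l.length fun d => l.getD d 0 := by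
    refine hite 1 ht (hite n hx1 (hp (hnum 2) (hp hx2 (hnum 0))) hc)
      (hite 2 ht (hp (hnum 2) (hp hx1 (Primrec.succ.comp hx2)))
      (hite 3 ht (hp (hnum 3) (hF hx)) (hite 4 ht (hp (hnum 4) (hp (hF hx1) (hF hx2)))
      (hite 5 ht (hp (hnum 5) (hp hx1 (hF hx2)))
      (hite 6 ht (hp (hnum 6) (hp (Primrec.succ.comp hx1) (hF hx2))) hc)))))
  have := Primrec.nat_strong_rec (fun (_ : Unit) c => absorbCode n c)
    (g := fun _ l => some (absorbStep n l.length fun d => l.getD d 0))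
    (Primrec.option_some.comp (hstep.comp Primrec.snd)) (by
      intro _ c
      rw [absorbCode_eq, List.length_map, List.length_range]
      refine congrArg some (absorbStep_congr n c fun d hd => ?_)
      simp [hd])
  exact this.comp (Primrec.const ()) Primrec.id

variable {N : ℕ} (lab : Fin N → MSO n)

/-- The code of `occ lab (a :: l)` as a function of the codes of its parts. -/
def occStep (s q a c : ℕ) : ℕ :=
  Nat.pair 4 (Nat.pair a (Nat.pair 5 (Nat.pair 1 (Nat.pair 4 (Nat.pair s (Nat.pair 5 (Nat.pair 0
    (Nat.pair 4 (Nat.pair q c)))))))))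

/-- The code of `occ lab l`. -/
def occCode (l : List (Fin N)) : ℕ :=
  l.foldr (fun a c => occStep (encode (isSucc (n := n))) (encode (isEq (n := n)))
    (encode (lab a)) c) (encode (not (lt 0 0) : MSO n))

lemma occCode_eq (l : List (Fin N)) : occCode lab l = encode (occ lab l) := by
  induction l with
  | nil => rfl
  | cons a l ih => simp_all [occCode, occStep, occ, encode]

/-- The code of a query as a function of the codes of its parts. -/
def queryCode (g o : ℕ) : ℕ :=
  Nat.pair 4 (Nat.pair (Nat.pair 6 (Nat.pair 0 (Nat.pair 5 (Nat.pair 0 o))))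
    (Nat.pair 3 (Nat.pair 6 (Nat.pair 0 (Nat.pair 4 (Nat.pair
      (Nat.pair 3 (Nat.pair 5 (Nat.pair 1 (Nat.pair 3 (Nat.pair 4 (Nat.pair
        (Nat.pair 5 (Nat.pair 0 (Nat.pair 4 (Nat.pair (encode (not (lt 1 0) : MSO 0)) o))))
        (Nat.pair 5 (Nat.pair 0 (Nat.pair 4 (Nat.pair (encode (not (lt 0 1) : MSO 0)) o))))))))))
      (Nat.pair 3 g)))))))

lemma queryCode_eq (φ : MSO (n + 1)) (l : List (Fin N)) :
    queryCode (absorbCode n (encode φ)) (occCode lab l) = encode (query lab φ l) := by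
  simp [queryCode, absorbCode_encode, occCode_eq, query, recOcc, encode]

/-- The code of `taut` as a function of the code of a formula. -/
def tautCode (n c : ℕ) : ℕ :=
  Nat.pair 6 (Nat.pair 0 (Nat.pair 3 (Nat.pair 4
    (Nat.pair (absorbCode n c) (Nat.pair 3 (absorbCode n c))))))

lemma tautCode_mem_iff (P : Fin n → Set ℤ) (c : ℕ) :
    tautCode n c ∈ TheoryCodes (fun x y : ℤ => x < y) P ↔
      ∃ φ : MSO (n + 1), IsSentence φ ∧ encode φ = c := by
  have htaut : ∀ φ : MSO (n + 1), tautCode n (encode φ) = encode (taut φ) := by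
    intro φ
    simp [tautCode, absorbCode_encode, taut, encode]
  constructor
  · rintro ⟨ψ, hψ, h, _⟩
    obtain ⟨χ, hχ⟩ : ∃ χ : MSO n, absorbCode n c = encode χ := by
      cases ψ with
      | ex2 j ψ =>
        cases ψ with
        | not ψ =>
          cases ψ with
          | and ψ ψ' =>
            simp only [tautCode, encode, Nat.pair_eq_pair] at h
            exact ⟨ψ, h.2.2.2.2.1.symm⟩
          | _ => simp [tautCode, encode, Nat.pair_eq_pair] at h
        | _ => simp [tautCode, encode, Nat.pair_eq_pair] at h
      | _ => simp [tautCode, encode, Nat.pair_eq_pair] at h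
    obtain ⟨φ, rfl, rfl⟩ := exists_of_absorbCode_eq χ c hχ
    rw [htaut] at h
    rw [encode_injective h, isSentence_taut_iff] at hψ
    exact ⟨φ, hψ, rfl⟩
  · rintro ⟨φ, hφ, rfl⟩
    rw [htaut, encode_mem_theoryCodes ((isSentence_taut_iff φ).mpr hφ)]
    exact trueIn_taut P φ

lemma primrec_occStep (s q : ℕ) : Primrec₂ (occStep s q) := by
  have hp : ∀ {f g : ℕ × ℕ → ℕ}, Primrec f → Primrec g →
      Primrec fun l => Nat.pair (f l) (g l) := fun hf hg => Primrec₂.natPair.comp hf hg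
  have hnum : ∀ k : ℕ, Primrec fun _ : ℕ × ℕ => k := fun k => Primrec.const k
  exact hp (hnum 4) (hp Primrec.fst (hp (hnum 5) (hp (hnum 1) (hp (hnum 4) (hp (hnum s)
    (hp (hnum 5) (hp (hnum 0) (hp (hnum 4) (hp (hnum q) Primrec.snd)))))))))

lemma primrec_foldr_fin {g : ℕ → ℕ → ℕ} (hg : Primrec₂ g) (z : ℕ) (f : Fin N → ℕ) :
    Primrec fun l : List (Fin N) => l.foldr (fun a c => g (f a) c) z := by
  have hf : Primrec f := Primrec.dom_finite _
  have hstep : Primrec₂ fun (_ : List (Fin N)) (b : Fin N × ℕ) => g (f b.1) b.2 :=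
    hg.comp (hf.comp (Primrec.fst.comp Primrec.snd)) (Primrec.snd.comp Primrec.snd)
  exact Primrec.list_foldr Primrec.id (Primrec.const z) hstep

lemma primrec_occCode : Primrec (occCode lab) :=
  primrec_foldr_fin (primrec_occStep _ _) _ _

lemma primrec_queryCode : Primrec₂ queryCode := by
  have hp : ∀ {f g : ℕ × ℕ → ℕ}, Primrec f → Primrec g →
      Primrec fun l => Nat.pair (f l) (g l) := fun hf hg => Primrec₂.natPair.comp hf hg
  have hnum : ∀ k : ℕ, Primrec fun _ : ℕ × ℕ => k := fun k => Primrec.const k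
  have ho : Primrec fun x : ℕ × ℕ => x.2 := Primrec.snd
  have hg : Primrec fun x : ℕ × ℕ => x.1 := Primrec.fst
  exact hp (hnum 4) (hp (hp (hnum 6) (hp (hnum 0) (hp (hnum 5) (hp (hnum 0) ho))))
    (hp (hnum 3) (hp (hnum 6) (hp (hnum 0) (hp (hnum 4) (hp
      (hp (hnum 3) (hp (hnum 5) (hp (hnum 1) (hp (hnum 3) (hp (hnum 4) (hp
        (hp (hnum 5) (hp (hnum 0) (hp (hnum 4) (hp (hnum _) ho))))
        (hp (hnum 5) (hp (hnum 0) (hp (hnum 4) (hp (hnum _) ho))))))))))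
      (hp (hnum 3) hg)))))))

lemma primrec_tautCode (n : ℕ) : Primrec (tautCode n) := by
  have hp : ∀ {f g : ℕ → ℕ}, Primrec f → Primrec g →
      Primrec fun l => Nat.pair (f l) (g l) := fun hf hg => Primrec₂.natPair.comp hf hg
  have hnum : ∀ k : ℕ, Primrec fun _ : ℕ => k := fun k => Primrec.const k
  have hg := primrec_absorbCode n
  exact hp (hnum 6) (hp (hnum 0) (hp (hnum 3) (hp (hnum 4) (hp hg (hp (hnum 3) hg)))))

end MSO

/-! ## Oracle computations -/

section Oracle

variable {O : ℕ →. ℕ}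

lemma RecursiveIn.of_partrec {f : ℕ →. ℕ} (hf : Nat.Partrec f) : RecursiveIn O f := by
  induction hf with
  | zero => exact .zero
  | succ => exact .succ
  | left => exact .left
  | right => exact .right
  | pair _ _ ih1 ih2 => exact .pair ih1 ih2
  | comp _ _ ih1 ih2 => exact .comp ih1 ih2
  | prec _ _ ih1 ih2 => exact .prec ih1 ih2
  | rfind _ ih => exact .rfind ih

/-- The total function `f` is recursive in the oracle `O`. -/
def TotalRecursiveIn (O : ℕ →. ℕ) (f : ℕ → ℕ) : Prop := RecursiveIn O fun x => Part.some (f x)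

lemma TotalRecursiveIn.of_primrec {f : ℕ → ℕ} (hf : Primrec f) : TotalRecursiveIn O f :=
  RecursiveIn.of_partrec (Nat.Partrec.of_primrec (Primrec.nat_iff.mp hf))

lemma TotalRecursiveIn.comp {f g : ℕ → ℕ} (hf : TotalRecursiveIn O f)
    (hg : TotalRecursiveIn O g) : TotalRecursiveIn O fun x => f (g x) := by
  have := RecursiveIn.comp hf hg
  simpa only [TotalRecursiveIn, Part.bind_eq_bind, Part.bind_some] using this

lemma TotalRecursiveIn.pair {f g : ℕ → ℕ} (hf : TotalRecursiveIn O f)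
    (hg : TotalRecursiveIn O g) : TotalRecursiveIn O fun x => Nat.pair (f x) (g x) := by
  have := RecursiveIn.pair hf hg
  simpa [Seq.seq, Part.map_some, TotalRecursiveIn] using this

lemma TotalRecursiveIn.comp₂ {h : ℕ → ℕ → ℕ} (hh : Primrec₂ h) {f g : ℕ → ℕ}
    (hf : TotalRecursiveIn O f) (hg : TotalRecursiveIn O g) :
    TotalRecursiveIn O fun x => h (f x) (g x) := by
  have h' : Primrec fun x : ℕ => h x.unpair.1 x.unpair.2 :=
    hh.comp (Primrec.fst.comp Primrec.unpair) (Primrec.snd.comp Primrec.unpair)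
  simpa using (TotalRecursiveIn.of_primrec h').comp (hf.pair hg)

/-- Unbounded search with a total test that always succeeds. -/
lemma TotalRecursiveIn.exists_search {f : ℕ → ℕ} (hf : TotalRecursiveIn O f)
    (h : ∀ a, ∃ m, f (Nat.pair a m) = 0) :
    ∃ μ : ℕ → ℕ, TotalRecursiveIn O μ ∧ ∀ a, f (Nat.pair a (μ a)) = 0 := by
  have hr := RecursiveIn.rfind hf
  have hdom : ∀ a, ∃ m, m ∈ Nat.rfind fun m =>
      (fun x => decide (x = 0)) <$> (Part.some (f (Nat.pair a m)) : Part ℕ) := by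
    intro a
    obtain ⟨m, hm⟩ := h a
    refine Part.dom_iff_mem.mp (Nat.rfind_dom.mpr ⟨m, ?_, fun _ => ?_⟩)
    · simp [hm]
    · simp
  choose μ hμ using hdom
  refine ⟨μ, ?_, fun a => ?_⟩
  · have : (fun a => Nat.rfind fun m =>
        (fun x => decide (x = 0)) <$> (Part.some (f (Nat.pair a m)) : Part ℕ)) =
        fun a => Part.some (μ a) := funext fun a => Part.eq_some_iff.mpr (hμ a)
    rw [TotalRecursiveIn, ← this]
    exact hr
  · have := Nat.rfind_spec (hμ a)
    simpa using this

end Oracle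

/-- The theory of an expansion in which all compatible words recur is recursive in the theory of
the structure. -/
theorem turingRed_of_recurs {n : ℕ} {P : Fin n → Set ℤ} {Q : Set ℤ}
    (hrec : Recurrent (wordOf P))
    (hQ : ∀ Z : List (Fin (n + 1) → Prop), OccursIn (wordOf P) (Z.map proj) →
      Recurs (wordOf (Fin.snoc (α := fun _ => Set ℤ) P Q)) Z) :
    TuringRed (MSO.TheoryCodes (fun x y : ℤ => x < y) (Fin.snoc (α := fun _ => Set ℤ) P Q))
      (MSO.TheoryCodes (fun x y : ℤ => x < y) P) := by
  classical
  set T := MSO.TheoryCodes (fun x y : ℤ => x < y) P with hT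
  obtain ⟨N, ⟨e⟩⟩ := Finite.exists_equiv_fin (Fin (n + 1) → Prop)
  choose lab hlab1 hlab2 hlab using fun a : Fin N => MSO.exists_label (e.symm a)
  have hlab : MSO.IsLabelling lab e.symm := hlab
  let words : ℕ → List (Fin N) := fun m => (Encodable.decode m).getD []
  let q : ℕ → ℕ → ℕ := fun c m =>
    MSO.queryCode (MSO.absorbCode n c) (MSO.occCode lab (words m))
  let χ : ℕ → ℕ := T.indicator fun _ => 1
  have hq : ∀ {φ : MSO (n + 1)} (_ : φ.IsSentence),
      MSO.TrueIn (fun x y : ℤ => x < y) (Fin.snoc (α := fun _ => Set ℤ) P Q) φ ↔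
        ∃ m, q (MSO.encode φ) m ∈ T := by
    intro φ hφ
    rw [MSO.trueIn_snoc_iff_exists_query hlab e.symm.surjective hrec hQ hφ]
    have hmem : ∀ l, MSO.encode (MSO.query lab φ l) ∈ T ↔
        MSO.TrueIn (fun x y : ℤ => x < y) P (MSO.query lab φ l) := fun l =>
      MSO.encode_mem_theoryCodes (MSO.isSentence_query hlab1 hlab2 hφ l)
    simp only [q, MSO.queryCode_eq, hmem]
    constructor
    · rintro ⟨l, hl⟩
      exact ⟨Encodable.encode l, by simpa [words] using hl⟩
    · rintro ⟨m, hm⟩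
      exact ⟨_, hm⟩
  have hqprim : Primrec₂ q := by
    have hwords : Primrec words :=
      Primrec.option_getD.comp Primrec.decode (Primrec.const [])
    exact MSO.primrec_queryCode.comp ((MSO.primrec_absorbCode n).comp Primrec.fst)
      ((MSO.primrec_occCode lab).comp (hwords.comp Primrec.snd))
  have hχ : TotalRecursiveIn (chi T) χ := RecursiveIn.oracle
  have hχ1 : ∀ {c}, c ∈ T → χ c = 1 := fun h => Set.indicator_of_mem h _
  have hχ0 : ∀ {c}, c ∉ T → χ c = 0 := fun h => Set.indicator_of_notMem h _
  have hleft : Primrec fun x : ℕ => x.unpair.1 := Primrec.fst.comp Primrec.unpair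
  have hright : Primrec fun x : ℕ => x.unpair.2 := Primrec.snd.comp Primrec.unpair
  have hneg : Primrec fun x : ℕ => Nat.pair 3 x.unpair.1 :=
    Primrec₂.natPair.comp (Primrec.const 3) hleft
  let test : ℕ → ℕ := fun x =>
    (1 - χ (q x.unpair.1 x.unpair.2)) * (1 - χ (q (Nat.pair 3 x.unpair.1) x.unpair.2)) *
      χ (MSO.tautCode n x.unpair.1)
  have hval : TotalRecursiveIn (chi T) fun x => χ (q x.unpair.1 x.unpair.2) :=
    hχ.comp (.of_primrec (hqprim.comp hleft hright))
  have htautχ : TotalRecursiveIn (chi T) fun x => χ (MSO.tautCode n x) :=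
    hχ.comp (.of_primrec (MSO.primrec_tautCode n))
  have htest : TotalRecursiveIn (chi T) test := by
    have hone : TotalRecursiveIn (chi T) fun _ => 1 := .of_primrec (Primrec.const 1)
    refine .comp₂ Primrec.nat_mul (.comp₂ Primrec.nat_mul (.comp₂ Primrec.nat_sub hone hval)
      (.comp₂ Primrec.nat_sub hone (hχ.comp (.of_primrec (hqprim.comp hneg hright)))))
      (htautχ.comp (.of_primrec hleft))
  have hcode : ∀ c, MSO.tautCode n c ∈ T ↔ ∃ φ : MSO (n + 1), φ.IsSentence ∧ φ.encode = c :=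
    MSO.tautCode_mem_iff P
  have htrue_not : ∀ {φ : MSO (n + 1)}, φ.IsSentence →
      (MSO.TrueIn (fun x y : ℤ => x < y) (Fin.snoc (α := fun _ => Set ℤ) P Q) φ.not ↔
      ¬ MSO.TrueIn (fun x y : ℤ => x < y) (Fin.snoc (α := fun _ => Set ℤ) P Q) φ) := by
    intro φ hφ
    constructor
    · exact fun h h' => h (fun _ => 0) (fun _ => ∅) (h' _ _)
    · exact fun h v V hv => h fun v' V' => (sat_sentence_iff hφ le_rfl rfl _ _ _ _).mp hv
  obtain ⟨μ, hμ, hμ0⟩ := htest.exists_search (by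
    intro c
    by_cases hc : MSO.tautCode n c ∈ T
    · obtain ⟨φ, hφ, rfl⟩ := (hcode c).mp hc
      by_cases h : MSO.TrueIn (fun x y : ℤ => x < y) (Fin.snoc (α := fun _ => Set ℤ) P Q) φ
      · obtain ⟨m, hm⟩ := (hq hφ).mp h
        exact ⟨m, by simp [test, hχ1 hm]⟩
      · obtain ⟨m, hm⟩ := (hq (φ := φ.not) hφ).mp ((htrue_not hφ).mpr h)
        exact ⟨m, by simp [test, hχ1 (show q (Nat.pair 3 φ.encode) m ∈ T from hm)]⟩
    · exact ⟨0, by simp [test, hχ0 hc]⟩)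
  have hout : TotalRecursiveIn (chi T) fun c => χ (q c (μ c)) * χ (MSO.tautCode n c) := by
    have := hval.comp (TotalRecursiveIn.pair (.of_primrec Primrec.id) hμ)
    simp only [Nat.unpair_pair, id] at this
    exact .comp₂ Primrec.nat_mul this htautχ
  have heq : chi (MSO.TheoryCodes (fun x y : ℤ => x < y) (Fin.snoc (α := fun _ => Set ℤ) P Q)) =
      fun c => Part.some (χ (q c (μ c)) * χ (MSO.tautCode n c)) := by
    funext c
    refine congrArg Part.some ?_
    by_cases hc : MSO.tautCode n c ∈ T
    · obtain ⟨φ, hφ, rfl⟩ := (hcode c).mp hc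
      have h0 := hμ0 φ.encode
      simp only [test, Nat.unpair_pair, hχ1 hc, mul_one] at h0 ⊢
      by_cases hm : q φ.encode (μ φ.encode) ∈ T
      · rw [hχ1 hm, Set.indicator_of_mem]
        exact (MSO.encode_mem_theoryCodes hφ).mpr ((hq hφ).mpr ⟨_, hm⟩)
      · rw [hχ0 hm, Set.indicator_of_notMem]
        rw [MSO.encode_mem_theoryCodes hφ, ← htrue_not hφ]
        refine (hq (φ := φ.not) hφ).mpr ⟨μ φ.encode, ?_⟩
        by_contra hm'
        have hm'' : q (Nat.pair 3 φ.encode) (μ φ.encode) ∉ T := hm'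
        simp [hχ0 hm, hχ0 hm''] at h0
    · rw [hχ0 hc, mul_zero, Set.indicator_of_notMem]
      rintro ⟨φ, hφ, h, _⟩
      exact hc ((hcode c).mpr ⟨φ, hφ, h⟩)
  rw [TuringRed, heq]
  exact hout

end Paper

/-- Let `M = (ℤ, <, P₁, …, Pₙ)` be recurrent and let
`M' = (ℤ, <, P₁, …, Pₙ, P_{n+1})` be an expansion satisfying property (*):
every finite word `u` over `{0,1}ⁿ` occurring in every prefix and every suffix
of `w(M)` is such that every word `u'` over `{0,1}^{n+1}` projecting letterwise
onto `u` occurs in every prefix and every suffix of `w(M')`.  Then `P_{n+1}` is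
not MSO-definable in `M` and the MSO theory of `M'` is recursive in the MSO
theory of `M`. -/
theorem stmt_15 {n : ℕ} (P : Fin n → Set ℤ) (Q : Set ℤ)
    (hrec : Recurrent (wordOf P))
    (hstar : ∀ u : List (Fin n → Prop),
      InEveryPrefix (wordOf P) u → InEverySuffix (wordOf P) u →
      ∀ u' : List (Fin (n + 1) → Prop),
        u'.map (fun f => fun k : Fin n => f k.castSucc) = u →
        InEveryPrefix (wordOf (Fin.snoc P Q)) u' ∧
        InEverySuffix (wordOf (Fin.snoc P Q)) u') :
    ¬ MSO.Definable (fun x y : ℤ => x < y) P Q ∧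
    TuringRed (MSO.TheoryCodes (fun x y : ℤ => x < y) (Fin.snoc P Q))
      (MSO.TheoryCodes (fun x y : ℤ => x < y) P) := by
  have hQ : ∀ Z : List (Fin (n + 1) → Prop), OccursIn (wordOf P) (Z.map proj) →
      Recurs (wordOf (Fin.snoc (α := fun _ => Set ℤ) P Q)) Z := by
    intro Z hZ
    have h := hrec.recurs hZ
    obtain ⟨h1, h2⟩ := hstar _ h.inEveryPrefix h.inEverySuffix Z rfl
    exact recurs_of_inEvery h1 h2
  exact ⟨not_definable_of_recurs hrec hQ, turingRed_of_recurs hrec hQ⟩
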